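/- arXiv:1603.04211 — 3 statements merged into one kernel-verified Lean document; each statement's English description precedes it below -/
import Mathlib

section
/- For n ≥ 14, letting m ≥ 3 satisfy f_{m+1} + 2f_{m−1} ≤ n < f_{m+2} + 2f_m − 1, the number of distinct cubes in 𝔽[1,n] is C(n) = n − f_{m+1} − f_{m−1} − m + 1 if n ≤ 2f_{m+1} − 2, and C(n) = f_m − m − 1 otherwise; and C(n) = 0 for n < 14. -/
/-- Finite Fibonacci words: `fibF 0 = a`, `fibF 1 = ab`,
`fibF (m+2) = fibF (m+1) ++ fibF m`, with letters `a = false`, `b = true`.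
Each `fibF m` is a prefix of the next, so a word is a factor of the infinite
Fibonacci word `𝔽` iff it is a factor (infix) of some `fibF m`. -/
def fibF : ℕ → List Bool
  | 0 => [false]
  | 1 => [false, true]
  | n + 2 => fibF (n + 1) ++ fibF n

/-- A word is a factor of the infinite Fibonacci word. -/
def IsFactorF (w : List Bool) : Prop := ∃ m, w <:+: fibF m

/-- The prefix `𝔽[1,n]` of the infinite Fibonacci word of length `n`
(`fibF n` has length `fib (n+2) ≥ n`). -/
def fibPrefix (n : ℕ) : List Bool := (fibF n).take n

/-- `A n`: the number of distinct squares in `𝔽[1,n]`. -/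
noncomputable def A (n : ℕ) : ℕ :=
  Set.ncard {w : List Bool | w ≠ [] ∧ (w ++ w) <:+: fibPrefix n}

/-- `C n`: the number of distinct cubes in `𝔽[1,n]`. -/
noncomputable def C (n : ℕ) : ℕ :=
  Set.ncard {w : List Bool | w ≠ [] ∧ (w ++ w ++ w) <:+: fibPrefix n}

namespace FibWord

/-- The infinite Fibonacci word, `false` and `true` standing for `a` and `b`. -/
def letter (n : ℕ) : Bool := (fibF n).getD n false

/-- The number of letters `a` among the first `n` letters. -/
def countA (n : ℕ) : ℕ := ∑ j ∈ Finset.range n, if letter j then 0 else 1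

/-- The start of the block `σ^(m-1)(letter i)` in the factorisation of the Fibonacci word into the
blocks `σ^(m-1)(a)`, of length `fib (m + 1)`, and `σ^(m-1)(b)`, of length `fib m`. -/
def blockStart (m i : ℕ) : ℕ :=
  ∑ j ∈ Finset.range i, if letter j then Nat.fib m else Nat.fib (m + 1)

/-- The factor of length `p` starting at position `i`. -/
def window (i p : ℕ) : List Bool := (List.range p).map fun t => letter (i + t)

theorem length_fibF : ∀ k, (fibF k).length = Nat.fib (k + 2)
  | 0 => rfl
  | 1 => rfl
  | k + 2 => by
    rw [fibF, List.length_append, length_fibF (k + 1), length_fibF k,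
      Nat.fib_add_two (n := k + 2)]
    exact add_comm _ _

theorem fibF_prefix_succ : ∀ k, fibF k <+: fibF (k + 1)
  | 0 => by simp [fibF]
  | k + 1 => by rw [fibF]; exact List.prefix_append _ _

theorem fibF_prefix_of_le {k l : ℕ} (h : k ≤ l) : fibF k <+: fibF l := by
  induction l, h using Nat.le_induction with
  | base => exact List.prefix_rfl
  | succ l _ ih => exact ih.trans (fibF_prefix_succ l)

theorem lt_fib_add_two (n : ℕ) : n < Nat.fib (n + 2) := by
  induction n with
  | zero => simp
  | succ n ih =>
    have : Nat.fib (n + 1 + 2) = Nat.fib (n + 1) + Nat.fib (n + 2) := Nat.fib_add_two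
    have : 0 < Nat.fib (n + 1) := Nat.fib_pos.2 (by omega)
    omega

theorem getElem?_fibF {k j : ℕ} (h : j < Nat.fib (k + 2)) : (fibF k)[j]? = some (letter j) := by
  have hj : (fibF j)[j]? = some (letter j) := by
    have : j < (fibF j).length := by rw [length_fibF]; exact lt_fib_add_two j
    simp [letter, this]
  have hk : (fibF k)[j]? = some ((fibF k)[j]'(by rwa [length_fibF])) :=
    List.getElem?_eq_getElem _
  rcases le_total k j with hkj | hkj
  · rw [← hj, hk, List.prefix_iff_getElem?.1 (fibF_prefix_of_le hkj)]
  · rw [← hj, List.getElem?_eq_getElem (l := fibF j) (by rw [length_fibF]; exact lt_fib_add_two j),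
      List.prefix_iff_getElem?.1 (fibF_prefix_of_le hkj)]

theorem letter_fib_add {k y : ℕ} (hk : 2 ≤ k) (hy : y < Nat.fib k) :
    letter (Nat.fib (k + 1) + y) = letter y := by
  obtain ⟨k, rfl⟩ : ∃ l, k = l + 2 := ⟨k - 2, by omega⟩
  have h₁ : (fibF (k + 2))[Nat.fib (k + 3) + y]? = some (letter (Nat.fib (k + 3) + y)) :=
    getElem?_fibF (by rw [Nat.fib_add_two (n := k + 2), add_comm]; exact Nat.add_lt_add_right hy _)
  rw [fibF, List.getElem?_append_right (by rw [length_fibF]; exact Nat.le_add_right _ _),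
    length_fibF, Nat.add_sub_cancel_left, getElem?_fibF hy] at h₁
  exact (Option.some.inj h₁).symm

theorem letter_zero : letter 0 = false := rfl

theorem letter_one : letter 1 = true := rfl

theorem countA_zero : countA 0 = 0 := rfl

theorem countA_succ (n : ℕ) : countA (n + 1) = countA n + if letter n then 0 else 1 :=
  Finset.sum_range_succ _ _

theorem countA_mono : Monotone countA :=
  monotone_nat_of_le_succ fun n => by rw [countA_succ]; omega

theorem countA_fib_add {k y : ℕ} (hk : 2 ≤ k) (hy : y ≤ Nat.fib k) :
    countA (Nat.fib (k + 1) + y) = countA (Nat.fib (k + 1)) + countA y := by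
  induction y with
  | zero => simp [countA_zero]
  | succ y ih =>
    rw [← add_assoc, countA_succ, countA_succ, ih (by omega), letter_fib_add hk (by omega),
      add_assoc]

theorem countA_fib : ∀ k, countA (Nat.fib (k + 2)) = Nat.fib (k + 1)
  | 0 => rfl
  | 1 => rfl
  | k + 2 => by
    rw [Nat.fib_add_two (n := k + 2), add_comm (Nat.fib (k + 2)),
      countA_fib_add (by omega) le_rfl, countA_fib (k + 1), countA_fib k,
      Nat.fib_add_two (n := k + 1)]
    exact add_comm _ _

theorem exists_fib_le_lt {n : ℕ} (hn : 1 ≤ n) :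
    ∃ k, 2 ≤ k ∧ Nat.fib k ≤ n ∧ n < Nat.fib (k + 1) := by
  induction n, hn using Nat.le_induction with
  | base => exact ⟨2, by decide⟩
  | succ n _ ih =>
    obtain ⟨k, hk, h₁, h₂⟩ := ih
    by_cases h : n + 1 < Nat.fib (k + 1)
    · exact ⟨k, hk, by omega, h⟩
    · exact ⟨k + 1, by omega, by omega,
        by have := Nat.fib_lt_fib_succ (n := k + 1) (by omega); omega⟩

/-- The Fibonacci word is fixed by `σ`: the image of the letter at `i` starts at `i + countA i`. -/
theorem letter_add_countA (i : ℕ) : letter (i + countA i) = false ∧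
    (letter i = false → letter (i + countA i + 1) = true) := by
  induction i using Nat.strong_induction_on with
  | _ i ih =>
    rcases Nat.lt_or_ge i 2 with hi | hi
    · interval_cases i <;> decide
    obtain ⟨k, hk, hle, hlt⟩ := exists_fib_le_lt (n := i) (by omega)
    have hk3 : 3 ≤ k := by
      by_contra h
      have : k = 2 := by omega
      subst this
      simp [Nat.fib] at hlt
      omega
    obtain ⟨k, rfl⟩ : ∃ l, k = l + 3 := ⟨k - 3, by omega⟩
    obtain ⟨y, rfl⟩ := Nat.exists_eq_add_of_le hle
    have e₁ : Nat.fib (k + 4) = Nat.fib (k + 2) + Nat.fib (k + 3) := Nat.fib_add_two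
    have e₂ : Nat.fib (k + 3) = Nat.fib (k + 1) + Nat.fib (k + 2) := Nat.fib_add_two
    have hy : y < Nat.fib (k + 2) := by rw [show k + 3 + 1 = k + 4 from rfl] at hlt; omega
    have hc : countA (Nat.fib (k + 3) + y) = Nat.fib (k + 2) + countA y := by
      rw [countA_fib_add (by omega) hy.le, countA_fib]
    have hpos : 0 < Nat.fib (k + 3) := Nat.fib_pos.2 (by omega)
    obtain ⟨ih₁, ih₂⟩ := ih y (by omega)
    have hm := countA_mono hy.le
    rw [countA_fib] at hm
    rw [hc, show Nat.fib (k + 3) + y + (Nat.fib (k + 2) + countA y)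
      = Nat.fib (k + 4) + (y + countA y) by omega]
    refine ⟨?_, fun h => ?_⟩
    · rw [letter_fib_add (by omega) (by omega), ih₁]
    · rw [letter_fib_add (by omega) hy] at h
      have hs := countA_mono (Nat.succ_le_of_lt hy)
      rw [countA_fib, Nat.succ_eq_add_one, countA_succ, h] at hs
      simp only [Bool.false_eq_true, if_false] at hs
      rw [add_assoc, letter_fib_add (by omega) (by omega), ih₂ h]

theorem blockStart_zero (m : ℕ) : blockStart m 0 = 0 := rfl

theorem blockStart_succ (m i : ℕ) : blockStart m (i + 1) =
    blockStart m i + if letter i then Nat.fib m else Nat.fib (m + 1) :=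
  Finset.sum_range_succ _ _

theorem blockStart_one (m : ℕ) : blockStart m 1 = Nat.fib (m + 1) := by
  simp [blockStart_succ, blockStart_zero, letter_zero]

theorem blockStart_two (m : ℕ) : blockStart m 2 = Nat.fib (m + 2) := by
  rw [blockStart_succ, blockStart_one, letter_one, Nat.fib_add_two]
  simp [add_comm]

theorem blockStart_two_left (i : ℕ) : blockStart 2 i = i + countA i := by
  induction i with
  | zero => rfl
  | succ i ih => rw [blockStart_succ, countA_succ, ih]; split_ifs <;> simp [Nat.fib] <;> omega

theorem blockStart_level_succ (m i : ℕ) :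
    blockStart (m + 1) i = blockStart m (i + countA i) := by
  induction i with
  | zero => rfl
  | succ i ih =>
    obtain ⟨h₁, h₂⟩ := letter_add_countA i
    rw [blockStart_succ, countA_succ, ih]
    cases h : letter i
    · rw [show i + 1 + (countA i + if false = true then 0 else 1) = i + countA i + 1 + 1 by
        simp; omega, blockStart_succ, blockStart_succ, h₁, h₂ h, Nat.fib_add_two]
      simp
      omega
    · rw [show i + 1 + (countA i + if true = true then 0 else 1) = i + countA i + 1 by
        simp; omega, blockStart_succ, h₁]
      simp

theorem blockStart_mono (m : ℕ) : Monotone (blockStart m) :=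
  monotone_nat_of_le_succ fun n => by rw [blockStart_succ]; omega

/-- Every position lies in a block. -/
theorem exists_block {m : ℕ} (hm : 1 ≤ m) (j : ℕ) :
    ∃ q r, j = blockStart m q + r ∧ r < if letter q then Nat.fib m else Nat.fib (m + 1) := by
  have p₁ : 0 < Nat.fib m := Nat.fib_pos.2 (by omega)
  have p₂ : 0 < Nat.fib (m + 1) := Nat.fib_pos.2 (by omega)
  induction j with
  | zero => exact ⟨0, 0, rfl, by split_ifs <;> assumption⟩
  | succ j ih =>
    obtain ⟨q, r, rfl, hr⟩ := ih
    by_cases h : r + 1 < if letter q then Nat.fib m else Nat.fib (m + 1)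
    · exact ⟨q, r + 1, by omega, h⟩
    · exact ⟨q + 1, 0, by rw [blockStart_succ]; omega, by split_ifs <;> assumption⟩

theorem letter_succ_of_true {j : ℕ} (h : letter j = true) : letter (j + 1) = false := by
  obtain ⟨q, r, rfl, hr⟩ := exists_block (m := 2) (by omega) j
  have h₀ := (letter_add_countA q).1
  have h₁ := (letter_add_countA (q + 1)).1
  rw [← blockStart_two_left] at h₀ h₁
  rw [blockStart_succ] at h₁
  cases hq : letter q <;> rw [hq] at hr h₁ <;> simp [Nat.fib] at hr h₁
  · interval_cases r
    · simp_all
    · exact h₁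
  · subst hr
    simp_all

/-- At every block start one reads a prefix of the Fibonacci word. -/
theorem letter_blockStart_add {m : ℕ} (hm : 3 ≤ m) :
    ∀ i x, x + 2 < Nat.fib (m + 2) → letter (blockStart m i + x) = letter x := by
  induction m, hm using Nat.le_induction with
  | base =>
    intro i x hx
    have hx : x < 3 := by simp [Nat.fib] at hx; omega
    rw [blockStart_level_succ]
    obtain ⟨h₁, -⟩ := letter_add_countA i
    obtain ⟨h₂, h₃⟩ := letter_add_countA (i + countA i)
    obtain ⟨h₄, -⟩ := letter_add_countA (i + countA i + 1)
    rw [← blockStart_two_left (i + countA i)] at h₂ h₃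
    rw [← blockStart_two_left (i + countA i + 1)] at h₄
    rw [blockStart_succ, h₁] at h₄
    interval_cases x
    · exact h₂
    · exact h₃ h₁
    · exact h₄
  | succ m hm ih =>
    intro i x hx
    have e₁ : Nat.fib (m + 3) = Nat.fib (m + 1) + Nat.fib (m + 2) := Nat.fib_add_two
    have e₂ : Nat.fib (m + 2) = Nat.fib m + Nat.fib (m + 1) := Nat.fib_add_two
    have e₃ : 2 ≤ Nat.fib m := Nat.fib_mono hm
    have hx : x + 2 < Nat.fib (m + 3) := hx
    rw [blockStart_level_succ]
    obtain ⟨h₁, -⟩ := letter_add_countA i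
    by_cases hlt : x < Nat.fib (m + 1)
    · exact ih _ _ (by omega)
    · obtain ⟨y, rfl⟩ := Nat.exists_eq_add_of_le (not_lt.1 hlt)
      have h := ih (i + countA i + 1) y (by omega)
      rw [blockStart_succ, h₁] at h
      simp only [Bool.false_eq_true, if_false] at h
      rw [← add_assoc, h, ← blockStart_one, ih 1 y (by omega)]

theorem letter_block_window {m q r t : ℕ} (hm : 3 ≤ m)
    (hr : r < if letter q then Nat.fib m else Nat.fib (m + 1)) (ht : t + 1 < Nat.fib (m + 1)) :
    letter (blockStart m q + r + t) = letter (r + t) := by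
  have e₂ : Nat.fib (m + 2) = Nat.fib m + Nat.fib (m + 1) := Nat.fib_add_two
  have e₃ : 2 ≤ Nat.fib m := Nat.fib_mono hm
  rw [add_assoc]
  by_cases hlt : r + t + 2 < Nat.fib (m + 2)
  · exact letter_blockStart_add hm _ _ hlt
  cases hq : letter q <;> rw [hq] at hr <;> simp at hr
  · obtain ⟨y, hy⟩ : ∃ y, r + t = Nat.fib (m + 1) + y := ⟨r + t - Nat.fib (m + 1), by omega⟩
    have h := letter_blockStart_add hm (q + 1) y (by omega)
    rw [blockStart_succ, hq] at h
    simp only [Bool.false_eq_true, if_false] at h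
    rw [hy, ← add_assoc, h, ← blockStart_one, letter_blockStart_add hm 1 y (by omega)]
  · omega

theorem sum_letter_zmod {m : ℕ} [NeZero (Nat.fib (m + 2))] :
    ∑ y : ZMod (Nat.fib (m + 2)), (if letter y.val then 0 else 1) = Nat.fib (m + 1) := by
  refine Eq.trans ?_ (countA_fib m)
  rw [countA]
  refine Finset.sum_bij (fun y _ => y.val) (fun y _ => Finset.mem_range.2 (ZMod.val_lt y))
    (fun a _ b _ h => ZMod.val_injective _ h) (fun b hb => ⟨b, Finset.mem_univ _, ?_⟩)
    (fun _ _ => rfl)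
  exact ZMod.val_cast_of_lt (Finset.mem_range.1 hb)

/-- A cyclic word whose weight is coprime to its length, and which agrees with its rotation by `d`
except possibly at one place, has `d` a multiple of its length. -/
theorem natCast_eq_zero_of_almost_periodic {N : ℕ} [NeZero N] (g : ZMod N → ℕ)
    (hg : N.Coprime (∑ y, g y)) (d : ℕ) (y₀ : ZMod N)
    (h : ∀ y, y ≠ y₀ → g (y + d) = g y) : (d : ZMod N) = 0 := by
  have hall : ∀ y, g (y + d) = g y := by
    have hs : ∑ y, g (y + d) = ∑ y, g y := Equiv.sum_comp (Equiv.addRight (d : ZMod N)) g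
    rw [← Finset.add_sum_erase _ _ (Finset.mem_univ y₀),
      ← Finset.add_sum_erase _ g (Finset.mem_univ y₀),
      Finset.sum_congr rfl fun y hy => h y (Finset.ne_of_mem_erase hy)] at hs
    intro y
    by_cases hy : y = y₀
    · subst hy; exact Nat.add_right_cancel hs
    · exact h y hy
  have hstep : ∀ x, ∑ j ∈ Finset.range d, g (x + 1 + j) = ∑ j ∈ Finset.range d, g (x + j) := by
    intro x
    have h₁ := Finset.sum_range_succ (fun j : ℕ => g (x + j)) d
    have h₂ := Finset.sum_range_succ' (fun j : ℕ => g (x + j)) d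
    simp only [Nat.cast_add, Nat.cast_one, Nat.cast_zero, add_zero, hall] at h₁ h₂
    have h₃ : ∀ j : ℕ, x + ((j : ZMod N) + 1) = x + 1 + j := fun j => by ring
    simp only [h₃] at h₂
    omega
  have hconst : ∀ x : ℕ,
      ∑ j ∈ Finset.range d, g ((x : ZMod N) + j) = ∑ j ∈ Finset.range d, g (0 + j) := by
    intro x
    induction x with
    | zero => simp
    | succ x ih => rw [Nat.cast_succ, hstep, ih]
  have hsum : ∑ x : ZMod N, ∑ j ∈ Finset.range d, g (x + j) = d * ∑ y, g y := by
    have hj : ∀ j : ℕ, ∑ x : ZMod N, g (x + j) = ∑ y, g y := fun j =>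
      Equiv.sum_comp (Equiv.addRight (j : ZMod N)) g
    rw [Finset.sum_comm]
    simp [hj]
  have hsum' : ∑ x : ZMod N, ∑ j ∈ Finset.range d, g (x + j)
      = N * ∑ j ∈ Finset.range d, g (0 + j) := by
    have hx : ∀ x : ZMod N,
        ∑ j ∈ Finset.range d, g (x + j) = ∑ j ∈ Finset.range d, g (0 + j) := fun x => by
      rw [← hconst x.val, ZMod.natCast_zmod_val]
    simp [hx]
  rw [ZMod.natCast_eq_zero_iff]
  exact hg.dvd_of_dvd_mul_right ⟨_, hsum.symm.trans hsum'⟩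

/-- A factor of length `fib (m + 1) - 1` determines its offset in its block. -/
theorem offset_unique {m r s : ℕ} (hm : 3 ≤ m) (hr : r < Nat.fib (m + 1))
    (hs : s < Nat.fib (m + 1))
    (h : ∀ t, t + 1 < Nat.fib (m + 1) → letter (r + t) = letter (s + t)) : r = s := by
  wlog hrs : r ≤ s generalizing r s
  · exact (this hs hr (fun t ht => (h t ht).symm) (by omega)).symm
  obtain ⟨m, rfl⟩ : ∃ l, m = l + 1 := ⟨m - 1, by omega⟩
  have : NeZero (Nat.fib (m + 2)) := ⟨(Nat.fib_pos.2 (by omega)).ne'⟩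
  have hper : ∀ x, x + 2 < 2 * Nat.fib (m + 2) →
      letter ((x : ℕ) : ZMod (Nat.fib (m + 2))).val = letter x := by
    intro x hx
    rw [ZMod.val_natCast]
    by_cases hlt : x < Nat.fib (m + 2)
    · rw [Nat.mod_eq_of_lt hlt]
    · obtain ⟨y, rfl⟩ := Nat.exists_eq_add_of_le (not_lt.1 hlt)
      have e : Nat.fib (m + 3) = Nat.fib (m + 1) + Nat.fib (m + 2) := Nat.fib_add_two
      rw [Nat.add_mod_left, Nat.mod_eq_of_lt (by omega), ← blockStart_one,
        letter_blockStart_add hm 1 y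
          (by rw [show m + 1 + 2 = m + 3 from rfl]; omega)]
  have key := natCast_eq_zero_of_almost_periodic
    (fun y : ZMod (Nat.fib (m + 2)) => if letter y.val then 0 else 1)
    (by rw [sum_letter_zmod]; exact (Nat.fib_coprime_fib_succ (m + 1)).symm) (s - r)
    ((r : ZMod (Nat.fib (m + 2))) - 1) (fun y hy => by
      set t := (y - r).val with ht
      have hy' : y = ((r + t : ℕ) : ZMod (Nat.fib (m + 2))) := by
        push_cast
        rw [ht, ZMod.natCast_zmod_val]
        ring
      have htN : t < Nat.fib (m + 2) := ZMod.val_lt _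
      have ht1 : t + 1 ≠ Nat.fib (m + 2) := by
        intro hc
        apply hy
        have : ((t + 1 : ℕ) : ZMod (Nat.fib (m + 2))) = 0 := by rw [hc]; simp
        push_cast at this
        rw [hy']
        push_cast
        linear_combination this
      have hadd : y + ((s - r : ℕ) : ZMod (Nat.fib (m + 2))) = ((s + t : ℕ) : ZMod _) := by
        rw [hy', ← Nat.cast_add]
        congr 1
        omega
      have hr' : r < Nat.fib (m + 2) := hr
      have hs' : s < Nat.fib (m + 2) := hs
      simp only [hadd]
      rw [hy', hper _ (by omega), hper _ (by omega),
        h t (show t + 1 < Nat.fib (m + 2) by omega)])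
  rw [ZMod.natCast_eq_zero_iff] at key
  have hs' : s < Nat.fib (m + 2) := hs
  have := Nat.eq_zero_of_dvd_of_lt key (by omega)
  omega

/-- Two occurrences of a factor of length `fib (m + 1) - 1` at distance less than `fib (m + 1)` are
at distance `fib m`, and the first one starts in a block of type `b`. -/
theorem eq_fib_of_return {m i p : ℕ} (hm : 3 ≤ m) (hp : 0 < p) (hpm : p < Nat.fib (m + 1))
    (h : ∀ t, t + 1 < Nat.fib (m + 1) → letter (i + t) = letter (i + p + t)) :
    p = Nat.fib m ∧ ∃ q r, letter q = true ∧ r < Nat.fib m ∧ i = blockStart m q + r := by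
  obtain ⟨q, r, hi, hr⟩ := exists_block (m := m) (by omega) i
  obtain ⟨q', r', hi', hr'⟩ := exists_block (m := m) (by omega) (i + p)
  have hle : Nat.fib m ≤ Nat.fib (m + 1) := Nat.fib_le_fib_succ
  obtain rfl : r = r' := by
    refine offset_unique hm (hr.trans_le (by split_ifs <;> omega))
      (hr'.trans_le (by split_ifs <;> omega)) fun t ht => ?_
    rw [← letter_block_window hm hr ht, ← letter_block_window hm hr' ht, ← hi, ← hi', h t ht]
  have hlt : q < q' := by
    by_contra hc
    have := blockStart_mono m (not_lt.1 hc)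
    omega
  have h1 := blockStart_mono m (Nat.succ_le_of_lt hlt)
  rw [Nat.succ_eq_add_one, blockStart_succ] at h1
  cases hq : letter q <;> rw [hq] at hr h1 <;> simp at hr h1
  · omega
  · refine ⟨?_, q, r, hq, hr, hi⟩
    rcases Nat.lt_or_ge (q + 1) q' with hq' | hq'
    · have h2 := blockStart_mono m (Nat.succ_le_of_lt hq')
      rw [Nat.succ_eq_add_one, blockStart_succ, letter_succ_of_true hq] at h2
      simp only [Bool.false_eq_true, if_false] at h2
      have h3 := blockStart_succ m q
      rw [hq] at h3
      simp at h3
      omega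
    · obtain rfl : q' = q + 1 := by omega
      rw [blockStart_succ, hq] at hi'
      simp at hi'
      omega

/-- Structure of the cubes of the Fibonacci word. -/
theorem cube_structure {i p : ℕ} (hp : 0 < p)
    (h : ∀ t, t < 2 * p → letter (i + t) = letter (i + p + t)) :
    ∃ k, 4 ≤ k ∧ p = Nat.fib k ∧
      ∃ q r, letter q = true ∧ r + 2 ≤ Nat.fib (k - 1) ∧ i = blockStart k q + r := by
  obtain ⟨k, hk, hpk, hlen⟩ : ∃ k, 3 ≤ k ∧ p < Nat.fib (k + 1) ∧
      Nat.fib (k + 1) ≤ 2 * p + 1 := by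
    rcases Nat.lt_or_ge 1 p with hp1 | hp1
    · obtain ⟨k, hk, h₁, h₂⟩ := exists_fib_le_lt (n := p) hp
      obtain ⟨k, rfl⟩ : ∃ l, k = l + 1 := ⟨k - 1, by omega⟩
      have hk3 : 3 ≤ k + 1 := by
        by_contra hc
        have : k = 1 := by omega
        subst this
        simp [Nat.fib] at h₂
        omega
      have e : Nat.fib (k + 1 + 1) = Nat.fib k + Nat.fib (k + 1) := Nat.fib_add_two
      have := Nat.fib_le_fib_succ (n := k)
      exact ⟨k + 1, hk3, h₂, by omega⟩
    · obtain rfl : p = 1 := by omega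
      exact ⟨3, by decide⟩
  have hret : ∀ s, s + Nat.fib (k + 1) ≤ 2 * p + 1 → p = Nat.fib k ∧
      ∃ q r, letter q = true ∧ r < Nat.fib k ∧ i + s = blockStart k q + r := by
    intro s hs
    refine eq_fib_of_return hk hp hpk fun t ht => ?_
    have := h (s + t) (by omega)
    rwa [← add_assoc, ← add_assoc, add_right_comm i p s] at this
  obtain ⟨hpf, q, r, hq, hr, hi⟩ := hret 0 (by omega)
  obtain ⟨k, rfl⟩ : ∃ l, k = l + 3 := ⟨k - 3, by omega⟩
  have e₁ : Nat.fib (k + 3 + 1) = Nat.fib (k + 2) + Nat.fib (k + 3) := Nat.fib_add_two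
  have e₂ : Nat.fib (k + 3) = Nat.fib (k + 1) + Nat.fib (k + 2) := Nat.fib_add_two
  have p₁ : 0 < Nat.fib (k + 2) := Nat.fib_pos.2 (by omega)
  obtain ⟨-, q', r', hq', hr', hi'⟩ := hret (Nat.fib (k + 1) + 1) (by omega)
  have hqq : q = q' := by
    rcases lt_trichotomy q q' with hlt | rfl | hlt
    · exfalso
      have hne : q' ≠ q + 1 := by
        rintro rfl
        simp [letter_succ_of_true hq] at hq'
      have h2 := blockStart_mono (k + 3) (show q + 1 + 1 ≤ q' by omega)
      rw [blockStart_succ, blockStart_succ, letter_succ_of_true hq, hq] at h2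
      simp at h2
      omega
    · rfl
    · exfalso
      have h2 := blockStart_mono (k + 3) (Nat.succ_le_of_lt hlt)
      rw [Nat.succ_eq_add_one, blockStart_succ, hq'] at h2
      simp at h2
      omega
  subst hqq
  have hr2 : r + 2 ≤ Nat.fib (k + 2) := by omega
  refine ⟨k + 3, ?_, hpf, q, r, hq, hr2, by omega⟩
  by_contra hc
  obtain rfl : k = 0 := by omega
  simp [Nat.fib] at hr2

theorem cube_at_first_block {k r : ℕ} (hk : 4 ≤ k) (hr : r + 2 ≤ Nat.fib (k - 1)) {t : ℕ}
    (ht : t < 2 * Nat.fib k) :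
    letter (Nat.fib (k + 1) + r + t) = letter (Nat.fib (k + 1) + r + Nat.fib k + t) := by
  obtain ⟨k, rfl⟩ : ∃ l, k = l + 1 := ⟨k - 1, by omega⟩
  rw [Nat.add_sub_cancel] at hr
  have e₁ : Nat.fib (k + 1 + 2) = Nat.fib (k + 1) + Nat.fib (k + 1 + 1) := Nat.fib_add_two
  have e₂ : Nat.fib (k + 1 + 1) = Nat.fib k + Nat.fib (k + 1) := Nat.fib_add_two
  have h₁ := letter_blockStart_add (m := k + 1) (by omega) 1 (r + t) (by omega)
  have h₂ := letter_blockStart_add (m := k + 1) (by omega) 2 (r + t) (by omega)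
  rw [blockStart_one] at h₁
  rw [blockStart_two] at h₂
  rw [show Nat.fib (k + 1 + 1) + r + Nat.fib (k + 1) + t = Nat.fib (k + 1 + 2) + (r + t) by omega,
    h₂, add_assoc, h₁]

theorem length_window (i p : ℕ) : (window i p).length = p := by simp [window]

theorem window_eq_iff {i j p : ℕ} :
    window i p = window j p ↔ ∀ t, t < p → letter (i + t) = letter (j + t) := by
  simp [window]

theorem window_append (i p q : ℕ) : window i p ++ window (i + p) q = window i (p + q) := by
  simp [window, List.range_add, add_assoc, Function.comp_def]

theorem fibPrefix_eq_window (n : ℕ) : fibPrefix n = window 0 n := by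
  refine List.ext_getElem? fun j => ?_
  have hn := lt_fib_add_two n
  rw [fibPrefix, List.getElem?_take]
  split_ifs with h
  · rw [getElem?_fibF (by omega)]
    simp [window, h]
  · simp [window, not_lt.1 h]

theorem infix_fibPrefix_iff {u : List Bool} {n : ℕ} :
    u <:+: fibPrefix n ↔ ∃ i, i + u.length ≤ n ∧ u = window i u.length := by
  rw [fibPrefix_eq_window]
  constructor
  · rintro ⟨s, t, h⟩
    have hl := congrArg List.length h
    simp only [List.length_append, length_window] at hl
    refine ⟨s.length, by omega, ?_⟩
    have hw : window 0 n = window 0 s.length ++ window s.length u.length ++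
        window (s.length + u.length) t.length := by
      have h₁ := window_append 0 s.length u.length
      have h₂ := window_append 0 (s.length + u.length) t.length
      rw [zero_add] at h₁ h₂
      rw [h₁, h₂, hl]
    rw [hw] at h
    exact (List.append_inj (List.append_inj h (by simp [length_window])).1
      (by simp [length_window])).2
  · rintro ⟨i, hi, hu⟩
    refine ⟨window 0 i, window (i + u.length) (n - (i + u.length)), ?_⟩
    have h₁ := window_append 0 i u.length
    have h₂ := window_append 0 (i + u.length) (n - (i + u.length))
    rw [zero_add] at h₁ h₂
    rw [← hu] at h₁
    rw [h₁, h₂]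
    congr 1
    omega

theorem cube_infix_iff {w : List Bool} {n : ℕ} : w ++ w ++ w <:+: fibPrefix n ↔
    ∃ i, i + 3 * w.length ≤ n ∧ w = window i w.length ∧
      ∀ t, t < 2 * w.length → letter (i + t) = letter (i + w.length + t) := by
  rw [infix_fibPrefix_iff]
  refine exists_congr fun i => ?_
  have hl : (w ++ w ++ w).length = w.length + w.length + w.length := by
    simp [add_assoc]
  rw [hl, show i + (w.length + w.length + w.length) = i + 3 * w.length by omega,
    ← window_append, ← window_append]
  refine and_congr_right fun _ => ⟨fun h => ?_, fun ⟨h₁, h₂⟩ => ?_⟩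
  · obtain ⟨h', h₃⟩ := List.append_inj h (by simp [length_window])
    obtain ⟨h₁, h₂⟩ := List.append_inj h' (by simp [length_window])
    refine ⟨h₁, ?_⟩
    rw [← window_eq_iff, two_mul, ← window_append, ← window_append, ← h₁, ← h₂, add_assoc, ← h₃]
  · rw [← window_eq_iff, two_mul, ← window_append, ← window_append, add_assoc] at h₂
    obtain ⟨h₃, h₄⟩ := List.append_inj h₂ (by simp [length_window])
    rw [← h₄, ← h₃, ← h₁]

/-- The cubes in `𝔽[1,n]` are indexed by the exponent `k` of their period `fib k` and their offset
`r` in a block. -/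
theorem cube_iff {w : List Bool} {n : ℕ} : (w ≠ [] ∧ w ++ w ++ w <:+: fibPrefix n) ↔
    ∃ k r, 4 ≤ k ∧ r + 2 ≤ Nat.fib (k - 1) ∧ Nat.fib (k + 2) + 2 * Nat.fib k + r ≤ n ∧
      window r (Nat.fib k) = w := by
  have hwin : ∀ {k r q : ℕ}, 4 ≤ k → r + 2 ≤ Nat.fib (k - 1) →
      window (blockStart k q + r) (Nat.fib k) = window r (Nat.fib k) := by
    intro k r q hk hr
    have h₁ : Nat.fib (k - 1) ≤ Nat.fib (k + 1) := Nat.fib_mono (by omega)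
    rw [window_eq_iff]
    intro t ht
    rw [add_assoc]
    refine letter_blockStart_add (by omega) q (r + t) ?_
    rw [Nat.fib_add_two]
    omega
  rw [cube_infix_iff]
  constructor
  · rintro ⟨hw, i, hi, hwi, h⟩
    obtain ⟨k, hk, hp, q, r, hq, hr, rfl⟩ := cube_structure (List.length_pos_iff.2 hw) h
    refine ⟨k, r, hk, hr, ?_, ?_⟩
    · have hq1 : 1 ≤ q := by
        by_contra hc
        obtain rfl : q = 0 := by omega
        simp [letter_zero] at hq
      have h₁ := blockStart_mono k hq1
      rw [blockStart_one] at h₁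
      rw [Nat.fib_add_two]
      omega
    · rw [hwi, hp, hwin hk hr]
  · rintro ⟨k, r, hk, hr, hn, rfl⟩
    have hpos : 0 < Nat.fib k := Nat.fib_pos.2 (by omega)
    rw [Nat.fib_add_two] at hn
    refine ⟨fun h => ?_, Nat.fib (k + 1) + r, ?_, ?_, ?_⟩
    · have := congrArg List.length h
      rw [length_window] at this
      simp at this
      omega
    · rw [length_window]; omega
    · rw [length_window, ← blockStart_one, hwin hk hr]
    · rw [length_window]
      exact fun t ht => cube_at_first_block hk hr ht

theorem window_injective {k r s : ℕ} (hk : 4 ≤ k) (hr : r + 2 ≤ Nat.fib (k - 1))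
    (hs : s + 2 ≤ Nat.fib (k - 1)) (h : window r (Nat.fib k) = window s (Nat.fib k)) : r = s := by
  have h₁ : Nat.fib (k - 1) ≤ Nat.fib k := Nat.fib_mono (by omega)
  have h₂ : Nat.fib k ≤ Nat.fib (k + 1) := Nat.fib_mono (by omega)
  have e₁ : Nat.fib (k + 2) = Nat.fib k + Nat.fib (k + 1) := Nat.fib_add_two
  have e₂ : Nat.fib (k + 1) = Nat.fib (k - 1) + Nat.fib k := by
    obtain ⟨k, rfl⟩ : ∃ l, k = l + 1 := ⟨k - 1, by omega⟩
    exact Nat.fib_add_two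
  rw [window_eq_iff] at h
  have hread : ∀ x, x + 2 < Nat.fib (k + 2) → letter (Nat.fib (k + 1) + x) = letter x := by
    intro x hx
    rw [← blockStart_one, letter_blockStart_add (by omega) 1 x hx]
  refine offset_unique (m := k) (by omega) (by omega) (by omega) fun t ht => ?_
  by_cases htk : t < Nat.fib k
  · exact h t htk
  obtain ⟨u, rfl⟩ := Nat.exists_eq_add_of_le (not_lt.1 htk)
  have hshift : ∀ {x}, x + 2 ≤ Nat.fib (k - 1) →
      letter (x + (Nat.fib k + u)) = letter (x + u) := by
    intro x hx
    have hc := cube_at_first_block hk hx (t := u) (by omega)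
    rw [add_assoc, add_assoc, add_assoc, hread _ (by omega), hread _ (by omega)] at hc
    exact hc.symm
  rw [hshift hr, hshift hs, h u (by omega)]

/-- The number of distinct cubes of period `fib k` in `𝔽[1,n]`. -/
def cubeCount (n k : ℕ) : ℕ :=
  min (Nat.fib (k - 1) - 1) (n + 1 - (Nat.fib (k + 2) + 2 * Nat.fib k))

theorem C_eq_sum {n M : ℕ} (hM : n < Nat.fib (M + 2) + 2 * Nat.fib M) :
    C n = ∑ k ∈ Finset.Ico 4 M, cubeCount n k := by
  let S := (Finset.Ico 4 M).sigma fun k => Finset.range (cubeCount n k)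
  let f : (Σ _ : ℕ, ℕ) → List Bool := fun x => window x.2 (Nat.fib x.1)
  have hset : {w : List Bool | w ≠ [] ∧ w ++ w ++ w <:+: fibPrefix n} = f '' S := by
    ext w
    rw [Set.mem_ofPred_eq, cube_iff]
    constructor
    · rintro ⟨k, r, hk, hr, hn, hw⟩
      refine ⟨⟨k, r⟩, ?_, hw⟩
      have hkM : k < M := by
        by_contra hc
        have h₁ : Nat.fib (M + 2) ≤ Nat.fib (k + 2) := Nat.fib_mono (by omega)
        have h₂ : Nat.fib M ≤ Nat.fib k := Nat.fib_mono (by omega)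
        omega
      simp only [S, cubeCount, Finset.coe_sigma, Set.mem_sigma_iff, Finset.mem_coe,
        Finset.mem_Ico, Finset.mem_range]
      omega
    · rintro ⟨⟨k, r⟩, hx, hw⟩
      simp only [S, cubeCount, Finset.coe_sigma, Set.mem_sigma_iff, Finset.mem_coe,
        Finset.mem_Ico, Finset.mem_range] at hx
      exact ⟨k, r, by omega, by omega, by omega, hw⟩
  have hinj : Set.InjOn f S := by
    rintro ⟨k, r⟩ hx ⟨l, s⟩ hy h
    simp only [S, cubeCount, Finset.coe_sigma, Set.mem_sigma_iff, Finset.mem_coe,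
      Finset.mem_Ico, Finset.mem_range] at hx hy
    have hl := congrArg List.length h
    simp only [f, length_window] at hl
    obtain rfl : k = l := by
      rcases lt_trichotomy k l with hkl | hkl | hkl
      · exact absurd hl ((Nat.fib_lt_fib (by omega)).2 hkl).ne
      · exact hkl
      · exact absurd hl ((Nat.fib_lt_fib (by omega)).2 hkl).ne'
    obtain rfl : r = s := window_injective hx.1.1 (by omega) (by omega) h
    rfl
  rw [C, hset, hinj.ncard_image, Set.ncard_coe_finset, Finset.card_sigma]
  simp

/-- The total number of distinct cubes of period `fib k` with `4 ≤ k < M`. -/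
theorem sum_fib_sub_one {M : ℕ} (hM : 4 ≤ M) :
    ∑ k ∈ Finset.Ico 4 M, (Nat.fib (k - 1) - 1) + M = Nat.fib M + 1 := by
  induction M, hM using Nat.le_induction with
  | base => simp [Nat.fib]
  | succ M hM ih =>
    obtain ⟨M, rfl⟩ : ∃ l, M = l + 1 := ⟨M - 1, by omega⟩
    have e : Nat.fib (M + 1 + 1) = Nat.fib M + Nat.fib (M + 1) := Nat.fib_add_two
    have : 0 < Nat.fib M := Nat.fib_pos.2 (by omega)
    rw [Finset.sum_Ico_succ_top hM, Nat.add_sub_cancel]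
    omega

theorem C_eq_zero_of_lt {n : ℕ} (hn : n < 14) : C n = 0 := by
  rw [C_eq_sum (M := 4) (by simp [Nat.fib]; omega)]
  simp

end FibWord

/-- With `f_m = Nat.fib (m + 2)`: `C n = 0` for `n < 14`, and for `n ≥ 14` and
`m ≥ 3` with `f_{m+1} + 2 f_{m-1} ≤ n < f_{m+2} + 2 f_m - 1`:
`C n = n - f_{m+1} - f_{m-1} - m + 1` if `n ≤ 2 f_{m+1} - 2`, and
`C n = f_m - m - 1` otherwise. -/
theorem stmt_14 :
    (∀ n : ℕ, n < 14 → C n = 0) ∧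
    (∀ n m : ℕ, 14 ≤ n → 3 ≤ m →
      Nat.fib (m + 3) + 2 * Nat.fib (m + 1) ≤ n →
      n < Nat.fib (m + 4) + 2 * Nat.fib (m + 2) - 1 →
      (C n : ℤ) =
        if n ≤ 2 * Nat.fib (m + 3) - 2 then
          (n : ℤ) - Nat.fib (m + 3) - Nat.fib (m + 1) - m + 1
        else
          (Nat.fib (m + 2) : ℤ) - m - 1) := by
  refine ⟨fun n hn => FibWord.C_eq_zero_of_lt hn, fun n m _ hm h₁ h₂ => ?_⟩
  have e₁ : Nat.fib (m + 2) = Nat.fib m + Nat.fib (m + 1) := Nat.fib_add_two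
  have e₂ : Nat.fib (m + 3) = Nat.fib (m + 1) + Nat.fib (m + 2) := Nat.fib_add_two
  have hpos : 0 < Nat.fib m := Nat.fib_pos.2 (by omega)
  have hfull : ∀ k ∈ Finset.Ico 4 (m + 1), FibWord.cubeCount n k = Nat.fib (k - 1) - 1 := by
    intro k hk
    rw [Finset.mem_Ico] at hk
    have f₁ : Nat.fib (k + 2) ≤ Nat.fib (m + 2) := Nat.fib_mono (by omega)
    have f₂ : Nat.fib k ≤ Nat.fib m := Nat.fib_mono (by omega)
    have f₃ : Nat.fib (k - 1) ≤ Nat.fib (m + 1) := Nat.fib_mono (by omega)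
    have f₄ : Nat.fib m ≤ Nat.fib (m + 1) := Nat.fib_le_fib_succ
    rw [FibWord.cubeCount]
    omega
  have hsum := FibWord.sum_fib_sub_one (M := m + 1) (by omega)
  rw [FibWord.C_eq_sum (M := m + 2) (by rw [show m + 2 + 2 = m + 4 from rfl]; omega),
    Finset.sum_Ico_succ_top (by omega), Finset.sum_congr rfl hfull, FibWord.cubeCount,
    Nat.add_sub_cancel, show m + 1 + 2 = m + 3 from rfl]
  split_ifs with h <;> omega
end

section
/- For m ≥ 6, the number of distinct cubes in the prefix of length f_m of the Fibonacci word is C(f_m) = f_{m−3} − m + 2, and C(f_m) = 0 for m ≤ 5. -/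
theorem length_fibF : ∀ n, (fibF n).length = Nat.fib (n + 2)
  | 0 => rfl
  | 1 => rfl
  | n + 2 => by
    rw [fibF, List.length_append, length_fibF (n + 1), length_fibF n, Nat.fib_add_two (n := n + 2)]
    exact Nat.add_comm ..

theorem lt_length_fibF (n : ℕ) : n < (fibF n).length := by
  rw [length_fibF]
  induction n with
  | zero => decide
  | succ n ih =>
    have := Nat.fib_add_two (n := n + 1)
    have := Nat.fib_pos.2 (Nat.succ_pos n)
    grind

theorem fibF_prefix_succ (n : ℕ) : fibF n <+: fibF (n + 1) := by
  cases n with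
  | zero => exact ⟨[true], rfl⟩
  | succ n => exact ⟨fibF n, rfl⟩

theorem fibF_prefix {m n : ℕ} (h : m ≤ n) : fibF m <+: fibF n := by
  induction n, h using Nat.le_induction with
  | base => exact List.prefix_rfl
  | succ n _ ih => exact ih.trans (fibF_prefix_succ n)

/-- The letter at (zero-based) position `n` of the infinite Fibonacci word. -/
def fibLetter (n : ℕ) : Bool := (fibF n).getD n false

theorem getElem_fibF {m n : ℕ} (h : n < (fibF m).length) :
    (fibF m)[n] = fibLetter n := by
  rw [fibLetter, List.getD_eq_getElem _ _ (lt_length_fibF n)]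
  rcases le_total m n with hmn | hmn
  · exact (fibF_prefix hmn).getElem h
  · exact ((fibF_prefix hmn).getElem (lt_length_fibF n)).symm

/-- The factor of length `p` starting at position `i` of the infinite Fibonacci word. -/
def fibFactor (i p : ℕ) : List Bool := (List.range p).map fun t => fibLetter (i + t)

@[simp]
theorem length_fibFactor (i p : ℕ) : (fibFactor i p).length = p := by simp [fibFactor]

@[simp]
theorem getElem_fibFactor (i p t : ℕ) (h : t < (fibFactor i p).length) :
    (fibFactor i p)[t] = fibLetter (i + t) := by simp [fibFactor]

theorem fibFactor_add (i p q : ℕ) :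
    fibFactor i (p + q) = fibFactor i p ++ fibFactor (i + p) q := by
  simp [fibFactor, List.range_add, Function.comp_def, add_assoc]

theorem fibFactor_eq_iff {i j p : ℕ} :
    fibFactor i p = fibFactor j p ↔ ∀ t < p, fibLetter (i + t) = fibLetter (j + t) := by
  simp [fibFactor]

theorem take_fibF {m n : ℕ} (h : n ≤ (fibF m).length) : (fibF m).take n = fibFactor 0 n := by
  apply List.ext_getElem
  · simpa using h
  · intro t h₁ h₂
    simp [getElem_fibF]

theorem fibPrefix_eq (n : ℕ) : fibPrefix n = fibFactor 0 n :=
  take_fibF (lt_length_fibF n).le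

theorem fibF_eq (m : ℕ) : fibF m = fibFactor 0 (Nat.fib (m + 2)) := by
  rw [← take_fibF (length_fibF m).ge, ← length_fibF, List.take_length]

theorem infix_fibPrefix_iff {u : List Bool} {N : ℕ} :
    u <:+: fibPrefix N ↔ ∃ i, i + u.length ≤ N ∧ u = fibFactor i u.length := by
  rw [fibPrefix_eq]
  constructor
  · rw [List.infix_iff_getElem?]
    rintro ⟨i, hi, h⟩
    rw [length_fibFactor] at hi
    refine ⟨i, by omega, List.ext_getElem (by simp) fun t h₁ h₂ => ?_⟩
    have := h t h₁
    rw [List.getElem?_eq_getElem (by simp; omega)] at this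
    simpa [add_comm, eq_comm] using this
  · rintro ⟨i, hi, h⟩
    obtain ⟨r, rfl⟩ := Nat.exists_eq_add_of_le hi
    rw [fibFactor_add, fibFactor_add, zero_add, ← h]
    exact List.infix_append ..

theorem cube_infix_fibPrefix_iff {w : List Bool} {N : ℕ} :
    (w ++ w ++ w) <:+: fibPrefix N ↔ ∃ i, i + 3 * w.length ≤ N ∧ w = fibFactor i w.length ∧
      ∀ t, i ≤ t → t < i + 2 * w.length → fibLetter t = fibLetter (t + w.length) := by
  rw [infix_fibPrefix_iff]
  generalize hp : w.length = p
  have e : (w ++ w ++ w).length = p + p + p := by simp [hp, add_assoc]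
  simp only [e, fibFactor_add]
  refine exists_congr fun i => and_congr (by omega) ?_
  constructor
  · intro h
    obtain ⟨h, h₃⟩ := List.append_inj' h (by simp [hp])
    obtain ⟨h₁, h₂⟩ := List.append_inj' h (by simp [hp])
    refine ⟨h₁, fun t h h' => ?_⟩
    have h₄ := fibFactor_eq_iff.1 (h₁.symm.trans h₂)
    have h₅ := fibFactor_eq_iff.1 (h₂.symm.trans h₃)
    obtain ⟨u, rfl⟩ := Nat.exists_eq_add_of_le h
    rcases lt_or_ge u p with hu | hu
    · rw [h₄ u hu]; congr 1; omega
    · obtain ⟨v, rfl⟩ := Nat.exists_eq_add_of_le hu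
      have := h₅ v (by omega)
      rw [← add_assoc, this]; congr 1; omega
  · rintro ⟨h₁, h⟩
    have h₄ : fibFactor i p = fibFactor (i + p) p := fibFactor_eq_iff.2 fun t ht => by
      rw [h _ (by omega) (by omega)]; congr 1; omega
    have h₅ : fibFactor (i + p) p = fibFactor (i + (p + p)) p := fibFactor_eq_iff.2 fun t ht => by
      rw [h _ (by omega) (by omega)]; congr 1; omega
    rw [← h₅, ← h₄, ← h₁]

/-- The image of a letter under the Fibonacci morphism `a ↦ ab`, `b ↦ a`. -/
def fibMorphism (b : Bool) : List Bool := cond b [false] [false, true]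

theorem flatMap_fibF : ∀ m, (fibF m).flatMap fibMorphism = fibF (m + 1)
  | 0 => rfl
  | 1 => rfl
  | m + 2 => by
    rw [fibF, List.flatMap_append, flatMap_fibF (m + 1), flatMap_fibF m, ← fibF]

/-- The length of the image under the Fibonacci morphism of the prefix of length `n`. -/
def imagePos : ℕ → ℕ
  | 0 => 0
  | n + 1 => imagePos n + cond (fibLetter n) 1 2

theorem length_flatMap_fibFactor (n : ℕ) :
    ((fibFactor 0 n).flatMap fibMorphism).length = imagePos n := by
  induction n with
  | zero => rfl
  | succ n ih =>
    rw [fibFactor_add, List.flatMap_append, List.length_append, ih, imagePos]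
    cases h : fibLetter n <;> simp [fibFactor, fibMorphism, h]

theorem imagePos_fib (m : ℕ) : imagePos (Nat.fib (m + 2)) = Nat.fib (m + 3) := by
  rw [← length_flatMap_fibFactor, ← fibF_eq, flatMap_fibF, length_fibF]

theorem flatMap_fibFactor (n : ℕ) :
    (fibFactor 0 n).flatMap fibMorphism = fibFactor 0 (imagePos n) := by
  have h : fibFactor 0 n <+: fibF n := by
    rw [← take_fibF (lt_length_fibF n).le]
    exact List.take_prefix ..
  have h' := h.flatMap fibMorphism
  rw [flatMap_fibF] at h'
  rw [← length_flatMap_fibFactor, ← take_fibF h'.length_le]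
  exact List.prefix_iff_eq_take.1 h'

theorem fibMorphism_fibLetter (n : ℕ) :
    fibMorphism (fibLetter n) = fibFactor (imagePos n) (cond (fibLetter n) 1 2) := by
  have h := flatMap_fibFactor (n + 1)
  rw [fibFactor_add, List.flatMap_append, flatMap_fibFactor, imagePos, fibFactor_add] at h
  simpa [fibFactor] using h

theorem fibLetter_imagePos (n : ℕ) : fibLetter (imagePos n) = false := by
  have h := fibMorphism_fibLetter n
  cases hn : fibLetter n <;> simp [hn, fibMorphism, fibFactor, List.range_succ] at h <;> grind

theorem imagePos_succ_of_false {n : ℕ} (h : fibLetter n = false) :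
    imagePos (n + 1) = imagePos n + 2 := by simp [imagePos, h]

theorem imagePos_succ_of_true {n : ℕ} (h : fibLetter n = true) :
    imagePos (n + 1) = imagePos n + 1 := by simp [imagePos, h]

theorem fibLetter_imagePos_add_one (n : ℕ) :
    fibLetter (imagePos n + 1) = !fibLetter n := by
  cases hn : fibLetter n
  · have h := fibMorphism_fibLetter n
    simp [hn, fibMorphism, fibFactor, List.range_succ] at h
    grind
  · rw [← imagePos_succ_of_true hn, fibLetter_imagePos]; rfl

theorem imagePos_strictMono : StrictMono imagePos :=
  strictMono_nat_of_lt_succ fun n => by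
    cases hn : fibLetter n <;> simp [imagePos, hn]

theorem exists_imagePos (t : ℕ) :
    ∃ n, t = imagePos n ∨ fibLetter n = false ∧ t = imagePos n + 1 := by
  induction t with
  | zero => exact ⟨0, .inl rfl⟩
  | succ t ih =>
    obtain ⟨n, rfl | ⟨hn, rfl⟩⟩ := ih
    · cases hn : fibLetter n
      · exact ⟨n, .inr ⟨hn, rfl⟩⟩
      · exact ⟨n + 1, .inl (imagePos_succ_of_true hn).symm⟩
    · exact ⟨n + 1, .inl (imagePos_succ_of_false hn).symm⟩

theorem exists_imagePos_of_false {t : ℕ} (h : fibLetter t = false) : ∃ n, t = imagePos n := by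
  obtain ⟨n, rfl | ⟨hn, rfl⟩⟩ := exists_imagePos t
  · exact ⟨n, rfl⟩
  · simp [fibLetter_imagePos_add_one, hn] at h

theorem fibLetter_succ_of_true {t : ℕ} (h : fibLetter t = true) : fibLetter (t + 1) = false := by
  obtain ⟨n, rfl | ⟨hn, rfl⟩⟩ := exists_imagePos t
  · simp [fibLetter_imagePos] at h
  · rw [add_assoc, ← imagePos_succ_of_false hn, fibLetter_imagePos]

theorem fibLetter_pred_of_true {t : ℕ} (h : fibLetter t = true) :
    ∃ r, t = r + 1 ∧ fibLetter r = false := by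
  obtain ⟨n, rfl | ⟨hn, rfl⟩⟩ := exists_imagePos t
  · simp [fibLetter_imagePos] at h
  · exact ⟨_, rfl, fibLetter_imagePos n⟩

theorem not_three_false {t : ℕ} (h₀ : fibLetter t = false) (h₁ : fibLetter (t + 1) = false) :
    fibLetter (t + 2) = true := by
  obtain ⟨n, rfl⟩ := exists_imagePos_of_false h₀
  rw [fibLetter_imagePos_add_one] at h₁
  have hn : fibLetter n = true := by simpa using h₁
  have := fibLetter_imagePos_add_one (n + 1)
  rw [imagePos_succ_of_true hn, fibLetter_succ_of_true hn] at this
  simpa using this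

theorem imagePos_add_two (n : ℕ) : imagePos n + 3 ≤ imagePos (n + 2) := by
  cases hn : fibLetter n
  · have := imagePos_succ_of_false hn
    have := imagePos_strictMono (show n + 1 < n + 2 by omega)
    omega
  · rw [imagePos_succ_of_false (fibLetter_succ_of_true hn), imagePos_succ_of_true hn]

theorem imagePos_add_le (n q : ℕ) : imagePos n + q ≤ imagePos (n + q) := by
  induction q with
  | zero => rfl
  | succ q ih => exact Nat.succ_le_of_lt (ih.trans_lt (imagePos_strictMono (Nat.lt_succ_self _)))

/-- Equal factors have images of equal length. -/
theorem imagePos_add_of_eq {a b M : ℕ} (h : ∀ t < M, fibLetter (a + t) = fibLetter (b + t)) :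
    ∀ t ≤ M, imagePos (a + t) + imagePos b = imagePos (b + t) + imagePos a := by
  intro t ht
  induction t with
  | zero => simp [add_comm]
  | succ t ih =>
    have := ih (by omega)
    rw [← add_assoc, ← add_assoc, imagePos, imagePos, h t ht]
    omega

/-- Equal factors have equal images, also when the common first letter of the image
of the following letter is appended. -/
theorem fibLetter_imagePos_add_of_eq {a b M : ℕ}
    (h : ∀ t < M, fibLetter (a + t) = fibLetter (b + t)) (t : ℕ)
    (ht : imagePos a + t ≤ imagePos (a + M)) :
    fibLetter (imagePos a + t) = fibLetter (imagePos b + t) := by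
  obtain ⟨r, hr⟩ := exists_imagePos (imagePos a + t)
  have har : a ≤ r := by
    by_contra! hlt
    have := imagePos_strictMono.monotone (show r + 1 ≤ a from hlt)
    have := imagePos_strictMono (show r < a from hlt)
    rcases hr with hr | ⟨hr, hr'⟩
    · omega
    · rw [imagePos_succ_of_false hr] at *; omega
  obtain ⟨u, rfl⟩ := Nat.exists_eq_add_of_le har
  rcases hr with hr | ⟨hf, hr⟩
  · have hu : u ≤ M := by
      have := imagePos_strictMono.le_iff_le.1 (hr ▸ ht)
      omega
    have := imagePos_add_of_eq h u hu
    rw [hr, show imagePos b + t = imagePos (b + u) by omega, fibLetter_imagePos,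
      fibLetter_imagePos]
  · have hu : u < M := by
      have := imagePos_strictMono.lt_iff_lt.1 (show imagePos (a + u) < imagePos (a + M) by omega)
      omega
    have := imagePos_add_of_eq h u hu.le
    rw [hr, show imagePos b + t = imagePos (b + u) + 1 by omega, fibLetter_imagePos_add_one,
      fibLetter_imagePos_add_one, h u hu]

theorem fib_le_two_mul (k : ℕ) : Nat.fib (k + 1) ≤ Nat.fib (k + 2) ∧
    Nat.fib (k + 2) ≤ 2 * Nat.fib (k + 1) ∧ 0 < Nat.fib (k + 1) := by
  have h₁ := Nat.fib_add_two (n := k)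
  have h₂ := Nat.fib_le_fib_succ (n := k)
  have := Nat.fib_pos.2 (Nat.succ_pos k)
  grind

theorem exists_fib_eq_add_two (m : ℕ) : ∃ r, Nat.fib (m + 3) = r + 2 ∧
    imagePos r + 3 = Nat.fib (m + 4) ∧ fibLetter r ≠ fibLetter (r + 1) := by
  have step {m r : ℕ} (hr : Nat.fib (m + 3) = r + 2) (hl : fibLetter r ≠ fibLetter (r + 1)) :
      imagePos r + 3 = Nat.fib (m + 4) := by
    rw [← imagePos_fib, hr, imagePos, imagePos]
    cases h₀ : fibLetter r <;> cases h₁ : fibLetter (r + 1) <;> simp_all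
  induction m with
  | zero => exact ⟨0, rfl, step (m := 0) rfl (by decide), by decide⟩
  | succ m ih =>
    obtain ⟨r, hr, hp, hl⟩ := ih
    have hl' : fibLetter (imagePos r + 1) ≠ fibLetter (imagePos r + 1 + 1) := by
      rw [fibLetter_imagePos_add_one]
      cases h₀ : fibLetter r
      · rw [add_assoc, ← imagePos_succ_of_false h₀, fibLetter_imagePos]; decide
      · rw [← imagePos_succ_of_true h₀, fibLetter_imagePos_add_one, fibLetter_succ_of_true h₀]
        decide
    exact ⟨imagePos r + 1, hp.symm, step (m := m + 1) hp.symm hl', hl'⟩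

/-- If two occurrences of a factor extend to the longest run of their kind, so do their images. -/
theorem eq_on_run_succ {k a b : ℕ}
    (h : ∀ t, t + 2 < Nat.fib (k + 4) → fibLetter (Nat.fib (k + 3) + t) = fibLetter (b + t))
    (ha : a = imagePos b) :
    ∀ t, t + 2 < Nat.fib (k + 5) → fibLetter (Nat.fib (k + 4) + t) = fibLetter (a + t) := by
  subst ha
  intro t ht
  obtain ⟨r, hr, hp, -⟩ := exists_fib_eq_add_two (k + 2)
  have e₁ := imagePos_fib (k + 1)
  have e₂ := Nat.fib_add_two (n := k + 3)
  have e₃ := Nat.fib_add_two (n := k + 4)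
  have : 2 ≤ Nat.fib (k + 4) := Nat.fib_mono (show 3 ≤ k + 4 by omega)
  simp only [add_assoc, Nat.reduceAdd] at *
  rw [← e₁]
  refine fibLetter_imagePos_add_of_eq (M := Nat.fib (k + 4) - 2) (fun t ht => h t (by omega)) t ?_
  rw [show Nat.fib (k + 3) + (Nat.fib (k + 4) - 2) = r by omega]
  omega

/-- The first run of period `Nat.fib (k + 2)` in the infinite Fibonacci word. -/
theorem first_run (k : ℕ) : ∀ t, t + 2 < Nat.fib (k + 4) →
    fibLetter (Nat.fib (k + 3) + t) = fibLetter (Nat.fib (k + 4) + t) := by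
  induction k with
  | zero =>
    intro t ht
    obtain rfl : t = 0 := by simp [Nat.fib] at ht; omega
    decide
  | succ k ih => exact eq_on_run_succ ih (imagePos_fib (k + 2)).symm

/-- Repetitions of exponent almost three have a Fibonacci number as period and are contained
in a copy of the first run of that period. -/
theorem exists_run {p : ℕ} (hp : 1 ≤ p) {i j : ℕ} (hij : i + 2 * p ≤ j + 1)
    (h : ∀ t, i ≤ t → t < j → fibLetter t = fibLetter (t + p)) :
    ∃ k n, p = Nat.fib (k + 2) ∧ n ≤ i ∧ j + 2 ≤ n + Nat.fib (k + 4) ∧ Nat.fib (k + 3) ≤ n ∧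
      ∀ t, t + 2 < Nat.fib (k + 4) → fibLetter (Nat.fib (k + 3) + t) = fibLetter (n + t) := by
  induction p using Nat.strong_induction_on generalizing i j with
  | _ p ih =>
  rcases hp.eq_or_lt with rfl | hp₂
  · have h₀ := h i le_rfl (by omega)
    have hi : fibLetter i = false := by
      by_contra hi
      rw [Bool.not_eq_false] at hi
      rw [fibLetter_succ_of_true hi, hi] at h₀
      contradiction
    have h₂ := not_three_false hi (h₀ ▸ hi)
    refine ⟨0, i, rfl, le_rfl, ?_, ?_, ?_⟩
    · by_contra! hj
      have := h (i + 1) (by omega) (by simp [Nat.fib] at hj; omega)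
      grind
    · change 2 ≤ i
      by_contra! hi₂
      interval_cases i <;> revert h₀ <;> decide
    · intro t ht
      obtain rfl : t = 0 := by simp [Nat.fib] at ht; omega
      rw [add_zero, add_zero, hi]; decide
  obtain ⟨i', hi', hia, hi⟩ : ∃ i' ≤ i, fibLetter i' = false ∧
      ∀ t, i' ≤ t → t < j → fibLetter t = fibLetter (t + p) := by
    cases hi : fibLetter i
    · exact ⟨i, le_rfl, hi, h⟩
    obtain ⟨r, rfl, hr⟩ := fibLetter_pred_of_true hi
    refine ⟨r, by omega, hr, fun t ht htj => ?_⟩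
    rcases ht.eq_or_lt with rfl | ht
    · rw [h _ le_rfl (by omega)] at hi
      obtain ⟨u, hu, hu'⟩ := fibLetter_pred_of_true hi
      rw [hr, show r + p = u by omega, hu']
    · exact h t ht htj
  clear h
  obtain ⟨j', hj', hja, h⟩ : ∃ j' ≥ j, fibLetter (j' - 1) = false ∧
      ∀ t, i' ≤ t → t < j' → fibLetter t = fibLetter (t + p) := by
    cases hj : fibLetter (j - 1)
    · exact ⟨j, le_rfl, hj, hi⟩
    have hj₁ := fibLetter_succ_of_true hj
    have hj₂ := fibLetter_succ_of_true (hi (j - 1) (by omega) (by omega) ▸ hj)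
    rw [show j - 1 + 1 = j by omega] at hj₁
    rw [show j - 1 + p + 1 = j + p by omega] at hj₂
    refine ⟨j + 1, by omega, by simpa using hj₁, fun t ht htj => ?_⟩
    rcases (show t ≤ j by omega).eq_or_lt with rfl | htj
    · rw [hj₁, hj₂]
    · exact hi t ht htj
  clear hi
  obtain ⟨n, rfl⟩ := exists_imagePos_of_false hia
  obtain ⟨n', hn'⟩ := exists_imagePos_of_false hja
  obtain ⟨m, hm⟩ := exists_imagePos_of_false (h _ le_rfl (by omega) ▸ hia)
  have hnm : n < m := imagePos_strictMono.lt_iff_lt.1 (by omega)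
  obtain ⟨q, rfl⟩ := Nat.exists_eq_add_of_le hnm.le
  have hnn : n ≤ n' := imagePos_strictMono.le_iff_le.1 (by omega)
  obtain ⟨v, rfl⟩ := Nat.exists_eq_add_of_le hnn
  have key : ∀ u ≤ v, imagePos (n + u) + p = imagePos (n + q + u) ∧
      ∀ t < u, fibLetter (n + t) = fibLetter (n + q + t) := by
    intro u hu
    induction u with
    | zero => simpa using hm
    | succ u ihu =>
      obtain ⟨h₁, h₂⟩ := ihu (by omega)
      have hlt := imagePos_strictMono (show n + u < n + v by omega)
      have hge := imagePos_strictMono.monotone (show n ≤ n + u by omega)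
      have h₃ := h (imagePos (n + u) + 1) (by omega) (by omega)
      rw [show imagePos (n + u) + 1 + p = imagePos (n + q + u) + 1 by omega,
        fibLetter_imagePos_add_one, fibLetter_imagePos_add_one, Bool.not_inj_iff] at h₃
      refine ⟨?_, fun t ht => ?_⟩
      · rw [← add_assoc, ← add_assoc, imagePos, imagePos, h₃]; omega
      · rcases (show t ≤ u by omega).eq_or_lt with rfl | ht
        · exact h₃
        · exact h₂ t ht
  have heq := (key v le_rfl).2
  have hqv : q ≤ v := by
    by_contra! hlt
    have := imagePos_strictMono (show n + v < n + q by omega)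
    omega
  have hqv₂ : 2 * q ≤ v + 1 := by
    by_contra! hlt
    have h₁ := (key q hqv).1
    have h₂ := imagePos_add_two (n + v)
    have h₃ := imagePos_strictMono.monotone (show n + v + 2 ≤ n + q + q by omega)
    omega
  have hqp : q < p := by
    rcases (show 1 ≤ q by omega).eq_or_lt with rfl | hq
    · omega
    have h₁ := imagePos_add_two n
    have h₂ := imagePos_add_le (n + 2) (q - 2)
    rw [show n + 2 + (q - 2) = n + q by omega] at h₂
    omega
  obtain ⟨k, n₀, hqk, hn₀, hn₁, hk, hr⟩ := ih q hqp (by omega) (i := n) (j := n + v) (by omega)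
    fun t ht htv => by
      obtain ⟨u, rfl⟩ := Nat.exists_eq_add_of_le ht
      rw [heq u (by omega)]; congr 1; omega
  obtain ⟨d, rfl⟩ := Nat.exists_eq_add_of_le hn₀
  obtain ⟨r, hr₁, hr₂, -⟩ := exists_fib_eq_add_two (k + 2)
  have f₁ := Nat.fib_add_two (n := k + 2)
  have f₂ := Nat.fib_add_two (n := k + 3)
  have f₃ := Nat.fib_add_two (n := k + 4)
  have e₁ := imagePos_fib (k + 1)
  have e₂ := imagePos_fib (k + 2)
  simp only [add_assoc, Nat.reduceAdd] at *
  have copy := imagePos_add_of_eq (M := Nat.fib (k + 4) - 2) fun t ht => hr t (by omega)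
  have c₁ := copy d (by omega)
  have c₂ := copy (d + q) (by omega)
  have c₃ := copy (Nat.fib (k + 4) - 2) le_rfl
  have c₄ := imagePos_add_of_eq (M := Nat.fib (k + 4) - 2) (fun t ht => first_run k t (by omega))
    d (by omega)
  rw [show Nat.fib (k + 4) + d = Nat.fib (k + 3) + (d + q) by omega] at c₄
  rw [show Nat.fib (k + 3) + (Nat.fib (k + 4) - 2) = r by omega] at c₃
  have hend := imagePos_strictMono.monotone
    (show n₀ + (d + v) ≤ n₀ + (Nat.fib (k + 4) - 2) by omega)
  refine ⟨k + 1, imagePos n₀, ?_, ?_, ?_, ?_, eq_on_run_succ hr rfl⟩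
  · change p = Nat.fib (k + 3)
    omega
  · exact (imagePos_strictMono.monotone (Nat.le_add_right n₀ d)).trans hi'
  · change j + 2 ≤ imagePos n₀ + Nat.fib (k + 5)
    omega
  · change Nat.fib (k + 4) ≤ _
    rw [← e₁]
    exact imagePos_strictMono.monotone hk
/-- The cube roots of period `Nat.fib (k + 2)` read off the first run of that period
are pairwise distinct. -/
theorem fibFactor_first_run_ne {k t d : ℕ} (hd : 1 ≤ d) (ht : t + d + 2 ≤ Nat.fib (k + 1)) :
    fibFactor (Nat.fib (k + 3) + t) (Nat.fib (k + 2)) ≠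
      fibFactor (Nat.fib (k + 3) + (t + d)) (Nat.fib (k + 2)) := by
  intro h
  rw [fibFactor_eq_iff] at h
  have := fib_le_two_mul k
  have := Nat.fib_add_two (n := k)
  have : Nat.fib (k + 3) = _ := Nat.fib_add_two (n := k + 1)
  have : Nat.fib (k + 4) = _ := Nat.fib_add_two (n := k + 2)
  simp only [add_assoc, Nat.reduceAdd] at *
  obtain ⟨l, n, hl, hn, hj, -⟩ := exists_run hd (i := Nat.fib (k + 3) + t)
    (j := Nat.fib (k + 3) + t + 2 * Nat.fib (k + 2)) (by omega) fun u hu hu' => by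
      obtain ⟨v, rfl⟩ := Nat.exists_eq_add_of_le hu
      rcases lt_or_ge v (Nat.fib (k + 2)) with hv | hv
      · rw [add_assoc, h v hv]; congr 1; omega
      · obtain ⟨x, rfl⟩ := Nat.exists_eq_add_of_le hv
        calc
          _ = fibLetter (Nat.fib (k + 4) + (t + x)) := by congr 1; omega
          _ = fibLetter (Nat.fib (k + 3) + (t + x)) := (first_run k _ (by omega)).symm
          _ = fibLetter (Nat.fib (k + 3) + (t + (d + x))) := h x (by omega)
          _ = fibLetter (Nat.fib (k + 4) + (t + (d + x))) := first_run k _ (by omega)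
          _ = _ := by congr 1; omega
  have hlk : l + 2 < k + 1 := by
    by_contra! hle
    have := Nat.fib_mono hle
    omega
  have := Nat.fib_mono (show l + 4 ≤ k + 2 by omega)
  omega

/-- The roots of the cubes in `fibPrefix (Nat.fib (m + 2))`. -/
theorem cubeRoots_eq (m : ℕ) :
    {w : List Bool | w ≠ [] ∧ (w ++ w ++ w) <:+: fibPrefix (Nat.fib (m + 2))} =
      (fun x : (_ : ℕ) × ℕ => fibFactor (Nat.fib (x.1 + 3) + x.2) (Nat.fib (x.1 + 2))) ''
        (((Finset.Icc 2 (m - 4)).sigma fun k => Finset.range (Nat.fib (k + 1) - 1) :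
          Finset ((_ : ℕ) × ℕ)) : Set ((_ : ℕ) × ℕ)) := by
  ext w
  rw [Set.mem_ofPred_eq, cube_infix_fibPrefix_iff, Set.mem_image]
  constructor
  · rintro ⟨hw, i, hi, hwi, h⟩
    obtain ⟨k, n, hp, hn, hj, hk, hr⟩ := exists_run (List.length_pos_iff.2 hw) (by omega) h
    generalize w.length = p at *
    subst hp
    obtain ⟨d, rfl⟩ := Nat.exists_eq_add_of_le hn
    have e₀ := Nat.fib_add_two (n := k)
    have e₁ := Nat.fib_add_two (n := k + 1)
    have e₂ := Nat.fib_add_two (n := k + 2)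
    have e₃ := Nat.fib_add_two (n := k + 3)
    simp only [add_assoc, Nat.reduceAdd] at *
    have hk₂ : 2 ≤ k := by
      by_contra! hlt
      have := Nat.fib_mono (show k + 1 ≤ 2 by omega)
      simp at this
      omega
    have : 0 < Nat.fib k := Nat.fib_pos.2 (by omega)
    have hkm : k + 4 ≤ m := by
      by_contra! hlt
      have := Nat.fib_mono (show m + 2 ≤ k + 5 by omega)
      omega
    refine ⟨⟨k, d⟩, ?_, ?_⟩
    · simp only [Finset.coe_sigma, Set.mem_sigma_iff, Finset.coe_Icc, Set.mem_Icc,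
        Finset.coe_range, Set.mem_Iio]
      omega
    · rw [hwi]
      refine fibFactor_eq_iff.2 fun t (ht : t < Nat.fib (k + 2)) => ?_
      rw [add_assoc, add_assoc, hr (d + t) (by omega)]
  · rintro ⟨⟨k, d⟩, hx, rfl⟩
    simp only [Finset.coe_sigma, Set.mem_sigma_iff, Finset.coe_Icc, Set.mem_Icc,
        Finset.coe_range, Set.mem_Iio] at hx
    have e₁ := Nat.fib_add_two (n := k + 1)
    have e₂ := Nat.fib_add_two (n := k + 2)
    have e₃ := Nat.fib_add_two (n := k + 3)
    have e₄ := Nat.fib_add_two (n := k + 4)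
    have := Nat.fib_mono (show k + 6 ≤ m + 2 by omega)
    have : 0 < Nat.fib (k + 2) := Nat.fib_pos.2 (by omega)
    simp only [add_assoc, Nat.reduceAdd, length_fibFactor] at *
    refine ⟨List.length_pos_iff.1 (by simp [this]), Nat.fib (k + 3) + d, by omega, rfl, ?_⟩
    intro t ht ht'
    obtain ⟨u, rfl⟩ := Nat.exists_eq_add_of_le ht
    rw [add_assoc, first_run k (d + u) (by omega)]
    congr 1; omega

theorem C_fib (m : ℕ) :
    C (Nat.fib (m + 2)) = ∑ k ∈ Finset.Icc 2 (m - 4), (Nat.fib (k + 1) - 1) := by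
  rw [C, cubeRoots_eq, Set.InjOn.ncard_image, Set.ncard_coe_finset, Finset.card_sigma]
  · simp
  rintro ⟨k, d⟩ hx ⟨l, e⟩ hy h
  simp only [Finset.coe_sigma, Set.mem_sigma_iff, Finset.coe_Icc, Set.mem_Icc,
        Finset.coe_range, Set.mem_Iio] at hx hy h
  have hkl := congrArg List.length h
  rw [length_fibFactor, length_fibFactor] at hkl
  obtain rfl : k = l := Nat.fib_add_two_strictMono.injective hkl
  rcases lt_trichotomy d e with hde | rfl | hde
  · obtain ⟨c, rfl⟩ := Nat.exists_eq_add_of_lt hde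
    exact absurd h (fibFactor_first_run_ne (d := c + 1) (by omega) (by omega))
  · rfl
  · obtain ⟨c, rfl⟩ := Nat.exists_eq_add_of_lt hde
    exact absurd h.symm (fibFactor_first_run_ne (d := c + 1) (by omega) (by omega))

/-- With `f_m = Nat.fib (m + 2)`: `C(f_m) = 0` for `m ≤ 5`, and
`C(f_m) = f_{m-3} - m + 2` for `m ≥ 6`. -/
theorem stmt_15 :
    (∀ m : ℕ, m ≤ 5 → C (Nat.fib (m + 2)) = 0) ∧
    (∀ m : ℕ, 6 ≤ m →
      (C (Nat.fib (m + 2)) : ℤ) = Nat.fib (m - 1) - m + 2) := by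
  refine ⟨fun m hm => ?_, fun m hm => ?_⟩
  · rw [C_fib, Finset.Icc_eq_empty (by omega), Finset.sum_empty]
  · rw [C_fib]
    induction m, hm using Nat.le_induction with
    | base => decide
    | succ m hm ih =>
      obtain ⟨r, rfl⟩ := Nat.exists_eq_add_of_le' hm
      have : Nat.fib (r + 6) = Nat.fib (r + 4) + Nat.fib (r + 5) := Nat.fib_add_two
      have : 0 < Nat.fib (r + 4) := Nat.fib_pos.2 (by omega)
      rw [show r + 6 + 1 - 4 = r + 2 + 1 by omega, Finset.sum_Icc_succ_top (by omega)]
      simp only [Nat.add_sub_cancel, show r + 2 + 1 + 1 = r + 4 by omega, show r + 6 - 4 = r + 2 by omega,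
        show r + 6 - 1 = r + 5 by omega] at ih ⊢
      push_cast at ih ⊢
      omega
end

section
/- For m ≥ 6, the number of cube occurrences in the prefix of length f_m of the Fibonacci word is D(f_m) = (m−11)/5 · f_{m−1} + (m+1)/5 · f_{m−3} + m + 1. -/
/-- `B n`: the number of occurrences of squares in `𝔽[1,n]`, i.e. the number of
pairs `(w, i)` with `w ≠ []` such that `ww` occurs in `𝔽[1,n]` starting at
(0-indexed) position `i`. -/
noncomputable def B (n : ℕ) : ℕ :=
  Set.ncard {q : List Bool × ℕ |
    q.1 ≠ [] ∧ (q.1 ++ q.1) <+: (fibPrefix n).drop q.2}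

/-- `D n`: the number of occurrences of cubes in `𝔽[1,n]`. -/
noncomputable def D (n : ℕ) : ℕ :=
  Set.ncard {q : List Bool × ℕ |
    q.1 ≠ [] ∧ (q.1 ++ q.1 ++ q.1) <+: (fibPrefix n).drop q.2}

open scoped goldenRatio

/-- The lower mechanical (Beatty) sequence `⌊N / φ⌋`, written with `-ψ = 1 / φ`. -/
noncomputable def beatty (N : ℤ) : ℤ := ⌊-ψ * N⌋

/-- The infinite Fibonacci word as a function. -/
noncomputable def fibWord (n : ℕ) : Bool := decide (beatty (n + 2) = beatty (n + 1))

/-- The `x`-th position at which translation by `fib (k + 1)` fails to raise `beatty`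
by exactly `fib k`. -/
noncomputable def jump (k : ℕ) (x : ℤ) : ℤ :=
  x * Nat.fib (k + 2) + beatty x * Nat.fib (k + 1)

lemma fib_add_two_int (k : ℕ) : (Nat.fib (k + 2) : ℤ) = Nat.fib k + Nat.fib (k + 1) := by
  rw [Nat.fib_add_two]; push_cast; ring

lemma beatty_zero : beatty 0 = 0 := by simp [beatty]

lemma beatty_succ (N : ℤ) : beatty (N + 1) = beatty N ∨ beatty (N + 1) = beatty N + 1 := by
  have h0 := Real.goldenConj_neg
  have h1 := Real.neg_one_lt_goldenConj
  have ha := Int.floor_le (-ψ * (N : ℝ))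
  have hb := Int.lt_floor_add_one (-ψ * (N : ℝ))
  unfold beatty
  push_cast
  have h2 : ⌊-ψ * (N : ℝ)⌋ ≤ ⌊-ψ * ((N : ℝ) + 1)⌋ := Int.floor_le_floor (by nlinarith)
  have h3 : ⌊-ψ * ((N : ℝ) + 1)⌋ < ⌊-ψ * (N : ℝ)⌋ + 2 := by
    rw [Int.floor_lt]; push_cast; nlinarith
  omega

lemma beatty_mono : Monotone beatty :=
  monotone_int_of_le_succ fun N => by rcases beatty_succ N with h | h <;> omega

lemma goldenConj_lin_ne_zero {x y : ℤ} (hx : x ≠ 0) : (y : ℝ) + x * ψ ≠ 0 := by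
  have := (Real.goldenConj_irrational.intCast_mul hx).intCast_add y
  exact this.ne_zero

lemma beatty_eq_iff {x y : ℤ} (hx : x ≠ 0) :
    beatty x = y ↔ -1 < (y : ℝ) + x * ψ ∧ (y : ℝ) + x * ψ < 0 := by
  have h := goldenConj_lin_ne_zero (y := y) hx
  unfold beatty
  rw [Int.floor_eq_iff]
  constructor
  · rintro ⟨h1, h2⟩
    exact ⟨by linarith, lt_of_le_of_ne (by linarith) h⟩
  · rintro ⟨h1, h2⟩
    exact ⟨by linarith, by linarith⟩

lemma exists_fib_coords (k : ℕ) (N r : ℤ) : ∃ x y : ℤ,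
    N = x * Nat.fib (k + 2) + y * Nat.fib (k + 1) ∧ r = x * Nat.fib (k + 1) + y * Nat.fib k := by
  induction k with
  | zero => exact ⟨r, N - r, by simp, by simp⟩
  | succ k ih =>
    obtain ⟨x, y, h1, h2⟩ := ih
    refine ⟨y, x - y, ?_, ?_⟩
    · rw [h1, fib_add_two_int (k + 1)]; ring
    · rw [h2, fib_add_two_int k]; ring

lemma neg_goldenConj_mul_coords (k : ℕ) (x y : ℤ) :
    -ψ * ((x * Nat.fib (k + 2) + y * Nat.fib (k + 1) : ℤ) : ℝ) =
      ((x * Nat.fib (k + 1) + y * Nat.fib k : ℤ) : ℝ) - ψ ^ (k + 1) * (y + x * ψ) := by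
  have h1 := Real.goldenConj_mul_fib_succ_add_fib k
  have h2 := Real.goldenConj_mul_fib_succ_add_fib (k + 1)
  push_cast
  have h3 : ψ ^ (k + 1 + 1) = ψ ^ (k + 1) * ψ := pow_succ _ _
  linear_combination (-(x : ℝ)) * h2 - (y : ℝ) * h1 - (x : ℝ) * h3

lemma beatty_add_fib (k : ℕ) (N : ℤ) :
    beatty (N + Nat.fib (k + 1)) = ⌊-ψ * N - ψ ^ (k + 1)⌋ + Nat.fib k := by
  have h1 := Real.goldenConj_mul_fib_succ_add_fib k
  unfold beatty
  rw [← Int.floor_add_intCast]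
  congr 1
  push_cast
  linear_combination -h1

lemma abs_goldenConj_pow_lt_one (k : ℕ) : |ψ ^ (k + 1)| < 1 := by
  rw [abs_pow]
  exact pow_lt_one₀ (abs_nonneg _)
    (abs_lt.2 ⟨Real.neg_one_lt_goldenConj, Real.goldenConj_neg.trans one_pos⟩) (by omega)

lemma fib_coords_pos_of_floor_ne {k : ℕ} {N : ℤ}
    (h : ⌊-ψ * (N : ℝ) - ψ ^ (k + 1)⌋ ≠ ⌊-ψ * (N : ℝ)⌋) :
    ∃ x y : ℤ, N = x * Nat.fib (k + 2) + y * Nat.fib (k + 1) ∧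
      -1 ≤ (y : ℝ) + x * ψ ∧ (y : ℝ) + x * ψ ≤ 0 := by
  have hlt := abs_lt.1 (abs_goldenConj_pow_lt_one k)
  have ha := Int.floor_le (-ψ * (N : ℝ))
  have hb := Int.lt_floor_add_one (-ψ * (N : ℝ))
  rcases lt_or_ge 0 (ψ ^ (k + 1)) with hpos | hneg
  · obtain ⟨x, y, hN, hr⟩ := exists_fib_coords k N ⌊-ψ * (N : ℝ)⌋
    have key := neg_goldenConj_mul_coords k x y
    rw [← hN, ← hr] at key
    refine ⟨x, y, hN, ?_, ?_⟩
    · by_contra! hc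
      apply h
      rw [Int.floor_eq_iff]
      constructor <;> nlinarith
    · by_contra! hc
      nlinarith
  · obtain ⟨x, y, hN, hr⟩ := exists_fib_coords k N (⌊-ψ * (N : ℝ)⌋ + 1)
    have key := neg_goldenConj_mul_coords k x y
    rw [← hN, ← hr] at key
    push_cast at key
    have hneg' : ψ ^ (k + 1) < 0 := lt_of_le_of_ne hneg (pow_ne_zero _ Real.goldenConj_ne_zero)
    refine ⟨x, y, hN, ?_, ?_⟩
    · by_contra! hc
      apply h
      rw [Int.floor_eq_iff]
      constructor <;> nlinarith
    · by_contra! hc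
      nlinarith

/-- Translation by `fib (k + 1)` is exact on `beatty` away from the values of `jump k`. -/
lemma beatty_add_fib_ne_iff {k : ℕ} {N : ℤ} (hN : 1 ≤ N) :
    beatty (N + Nat.fib (k + 1)) ≠ beatty N + Nat.fib k ↔ ∃ x : ℤ, 1 ≤ x ∧ N = jump k x := by
  have hf1 : (0 : ℤ) < Nat.fib (k + 1) := by exact_mod_cast Nat.fib_pos.2 (by omega)
  have hf2 : (0 : ℤ) < Nat.fib (k + 2) := by exact_mod_cast Nat.fib_pos.2 (by omega)
  rw [beatty_add_fib, ne_eq, add_left_inj]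
  constructor
  · intro h
    obtain ⟨x, y, hxy, h1, h2⟩ := fib_coords_pos_of_floor_ne h
    have hx : x ≠ 0 := by
      rintro rfl
      have : y ≤ 0 := by exact_mod_cast (by simpa using h2 : (y : ℝ) ≤ 0)
      nlinarith
    have h3 := lt_of_le_of_ne h2 (goldenConj_lin_ne_zero hx)
    have h4 : (-1 : ℝ) < y + x * ψ := by
      refine lt_of_le_of_ne h1 fun hc => goldenConj_lin_ne_zero (y := y + 1) hx ?_
      push_cast; linarith
    have hy := (beatty_eq_iff hx).2 ⟨h4, h3⟩
    refine ⟨x, ?_, by rw [hxy, jump, hy]⟩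
    by_contra! hc
    have : beatty x ≤ beatty 0 := beatty_mono (by omega)
    rw [beatty_zero, hy] at this
    nlinarith
  · rintro ⟨x, hx, rfl⟩ h
    have hx0 : x ≠ 0 := by omega
    obtain ⟨h1, h2⟩ := (beatty_eq_iff hx0).1 rfl
    have key := neg_goldenConj_mul_coords k x (beatty x)
    rw [← jump] at key
    set r : ℤ := x * Nat.fib (k + 1) + beatty x * Nat.fib k
    set z := ψ ^ (k + 1)
    change _ = ⌊-ψ * (jump k x : ℝ)⌋ at h
    rcases lt_or_ge 0 z with hpos | hneg
    · have ha : r ≤ ⌊-ψ * (jump k x : ℝ)⌋ := Int.le_floor.2 (by nlinarith)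
      have hb : ⌊-ψ * (jump k x : ℝ) - z⌋ < r := Int.floor_lt.2 (by nlinarith)
      omega
    · have hneg' : z < 0 := lt_of_le_of_ne hneg (pow_ne_zero _ Real.goldenConj_ne_zero)
      have ha : ⌊-ψ * (jump k x : ℝ)⌋ < r := Int.floor_lt.2 (by nlinarith)
      have hb : r ≤ ⌊-ψ * (jump k x : ℝ) - z⌋ := Int.le_floor.2 (by nlinarith)
      omega

lemma jump_zero (k : ℕ) : jump k 0 = 0 := by simp [jump, beatty_zero]

lemma jump_succ (k : ℕ) (x : ℤ) :
    beatty (x + 1) = beatty x ∧ jump k (x + 1) = jump k x + Nat.fib (k + 2) ∨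
      beatty (x + 1) = beatty x + 1 ∧ jump k (x + 1) = jump k x + Nat.fib (k + 3) := by
  have h3 := fib_add_two_int (k + 1)
  unfold jump
  rcases beatty_succ x with h | h
  · exact Or.inl ⟨h, by rw [h]; ring⟩
  · exact Or.inr ⟨h, by rw [h, show k + 3 = k + 1 + 2 from rfl, h3]; ring⟩

lemma jump_add_le {k : ℕ} {x y : ℤ} (h : x ≤ y) :
    jump k x + (y - x) * Nat.fib (k + 2) ≤ jump k y := by
  have := mul_le_mul_of_nonneg_right (beatty_mono h) (Int.natCast_nonneg (Nat.fib (k + 1)))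
  unfold jump
  nlinarith

lemma fib_add_two_le_jump {k : ℕ} {x : ℤ} (h : 1 ≤ x) : (Nat.fib (k + 2) : ℤ) ≤ jump k x := by
  have := jump_add_le (k := k) (show 0 ≤ x by omega)
  rw [jump_zero] at this
  nlinarith

lemma jump_lt_iff {k : ℕ} {x y : ℤ} : jump k x < jump k y ↔ x < y := by
  have hf2 : (0 : ℤ) < Nat.fib (k + 2) := by exact_mod_cast Nat.fib_pos.2 (by omega)
  constructor
  · intro h
    by_contra! hc
    have := jump_add_le (k := k) hc
    nlinarith
  · intro h
    have := jump_add_le (k := k) h.le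
    nlinarith

/-- Every window of `fib (k + 3)` consecutive positions contains a jump. -/
lemma exists_jump_mem {k : ℕ} {a : ℤ} (ha : 0 ≤ a) :
    ∃ x : ℤ, 1 ≤ x ∧ a < jump k x ∧ jump k x ≤ a + Nat.fib (k + 3) := by
  have hf : (Nat.fib (k + 2) : ℤ) ≤ Nat.fib (k + 3) := by exact_mod_cast Nat.fib_le_fib_succ
  lift a to ℕ using ha
  induction a with
  | zero =>
    refine ⟨1, le_rfl, ?_, ?_⟩
    · have := jump_lt_iff (k := k) (x := 0) (y := 1)
      rw [jump_zero] at this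
      exact this.2 one_pos
    · have := jump_succ k 0
      rw [jump_zero] at this
      norm_num at this ⊢
      omega
  | succ a ih =>
    obtain ⟨x, hx, h1, h2⟩ := ih
    rcases (show ((a + 1 : ℕ) : ℤ) ≤ jump k x by push_cast; omega).lt_or_eq with h | h
    · exact ⟨x, hx, h, by push_cast; omega⟩
    · refine ⟨x + 1, by omega, ?_, ?_⟩
      · rw [h]; exact jump_lt_iff.2 (by omega)
      · rcases jump_succ k x with ⟨-, h⟩ | ⟨-, h⟩ <;> omega

lemma beatty_add_fib_of_lt {k : ℕ} {N : ℤ} (h1 : 1 ≤ N) (h2 : N < Nat.fib (k + 2)) :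
    beatty (N + Nat.fib (k + 1)) = beatty N + Nat.fib k := by
  by_contra h
  obtain ⟨x, hx, hN⟩ := (beatty_add_fib_ne_iff h1).1 h
  have := fib_add_two_le_jump (k := k) hx
  omega

lemma fibWord_fib_add {m n : ℕ} (h : n < Nat.fib (m + 2)) :
    fibWord (Nat.fib (m + 3) + n) = fibWord n := by
  have h4 : Nat.fib (m + 4) = Nat.fib (m + 2) + Nat.fib (m + 3) := Nat.fib_add_two
  have h3 : 2 ≤ Nat.fib (m + 3) := Nat.fib_mono (show 3 ≤ m + 3 by omega)
  have e1 := beatty_add_fib_of_lt (k := m + 2) (N := n + 1) (by omega) (by push_cast [h4]; omega)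
  have e2 := beatty_add_fib_of_lt (k := m + 2) (N := n + 2) (by omega) (by push_cast [h4]; omega)
  unfold fibWord
  rw [decide_eq_decide]
  push_cast
  rw [show (Nat.fib (m + 3) : ℤ) + n + 2 = n + 2 + Nat.fib (m + 3) by ring,
    show (Nat.fib (m + 3) : ℤ) + n + 1 = n + 1 + Nat.fib (m + 3) by ring, e1, e2]
  omega

lemma goldenConj_lt_neg_half : ψ < -1 / 2 := by
  nlinarith [Real.goldenConj_sq, Real.goldenConj_neg]

lemma neg_two_thirds_lt_goldenConj : -2 / 3 < ψ := by
  nlinarith [Real.goldenConj_sq, Real.goldenConj_neg]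

lemma fibWord_zero : fibWord 0 = false := by
  have h1 := goldenConj_lt_neg_half
  have h2 := neg_two_thirds_lt_goldenConj
  have e1 : beatty 1 = 0 := (beatty_eq_iff one_ne_zero).2 (by constructor <;> push_cast <;> linarith)
  have e2 : beatty 2 = 1 := (beatty_eq_iff two_ne_zero).2 (by constructor <;> push_cast <;> linarith)
  simp [fibWord, e1, e2]

lemma fibWord_one : fibWord 1 = true := by
  have h1 := goldenConj_lt_neg_half
  have h2 := neg_two_thirds_lt_goldenConj
  have e2 : beatty 2 = 1 := (beatty_eq_iff two_ne_zero).2 (by constructor <;> push_cast <;> linarith)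
  have e3 : beatty 3 = 1 := (beatty_eq_iff three_ne_zero).2 (by constructor <;> push_cast <;> linarith)
  simp [fibWord, e2, e3]

lemma fibF_eq_map (m : ℕ) : fibF m = (List.range (Nat.fib (m + 2))).map fibWord := by
  induction m using Nat.twoStepInduction with
  | zero => simp [fibF, fibWord_zero]
  | one => simp [fibF, show Nat.fib 3 = 2 from rfl, List.range_succ, fibWord_zero, fibWord_one]
  | more m ih1 ih2 =>
    have h4 : Nat.fib (m + 2 + 2) = Nat.fib (m + 3) + Nat.fib (m + 2) := by
      rw [Nat.fib_add_two, add_comm]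
    rw [fibF, ih1, ih2, h4, List.range_add, List.map_append, List.map_map]
    congr 1
    refine List.map_congr_left fun n hn => ?_
    exact (fibWord_fib_add (List.mem_range.1 hn)).symm

lemma fibPrefix_eq_map (n : ℕ) : fibPrefix n = (List.range n).map fibWord := by
  have h : n ≤ Nat.fib (n + 2) := by have := Nat.le_fib_add_one (n + 2); omega
  rw [fibPrefix, fibF_eq_map, ← List.map_take, List.take_range, min_eq_left h]

/-- The infinite Fibonacci word has a cube of period `p` starting at position `i`. -/
def IsCubeAt (p i : ℕ) : Prop := 0 < p ∧ ∀ j < 2 * p, fibWord (i + j) = fibWord (i + j + p)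

open Classical in
/-- The cubes, as pairs (period, position), inside the prefix of length `n`. -/
noncomputable def cubes (n : ℕ) : Finset (ℕ × ℕ) :=
  (Finset.range (n + 1) ×ˢ Finset.range (n + 1)).filter
    fun q => q.2 + 3 * q.1 ≤ n ∧ IsCubeAt q.1 q.2

lemma mem_cubes {n p i : ℕ} : (p, i) ∈ cubes n ↔ i + 3 * p ≤ n ∧ IsCubeAt p i := by
  simp only [cubes, Finset.mem_filter, Finset.mem_product, Finset.mem_range]
  constructor
  · exact fun h => h.2
  · exact fun h => ⟨by omega, h⟩

lemma cube_prefix_iff {n i : ℕ} {w : List Bool} (hw : w ≠ []) :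
    (w ++ w ++ w) <+: ((List.range n).map fibWord).drop i ↔
      i + 3 * w.length ≤ n ∧ IsCubeAt w.length i ∧
        w = (List.range w.length).map fun j => fibWord (i + j) := by
  have hpos : 0 < w.length := List.length_pos_iff.2 hw
  rw [List.prefix_iff_getElem]
  constructor
  · rintro ⟨hlen, h⟩
    simp only [List.length_append, List.length_drop, List.length_map, List.length_range] at hlen
    simp only [List.length_append, List.getElem_drop, List.getElem_map, List.getElem_range] at h
    have hw0 : ∀ j (hj : j < w.length), w[j] = fibWord (i + j) := fun j hj => by
      rw [← h j (by omega), List.getElem_append_left (by simp; omega),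
        List.getElem_append_left hj]
    have hw1 : ∀ j (hj : j < w.length), w[j] = fibWord (i + (w.length + j)) := fun j hj => by
      rw [← h (w.length + j) (by omega), List.getElem_append_left (by simp; omega),
        List.getElem_append_right (by omega)]
      simp
    have hw2 : ∀ j (hj : j < w.length), w[j] = fibWord (i + (w.length + w.length + j)) :=
      fun j hj => by
        rw [← h (w.length + w.length + j) (by omega), List.getElem_append_right (by simp)]
        simp
    refine ⟨by omega, ⟨hpos, fun j hj => ?_⟩, ?_⟩
    · rcases lt_or_ge j w.length with hj' | hj'
      · rw [← hw0 j hj', hw1 j hj']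
        congr 1; omega
      · obtain ⟨l, rfl⟩ := Nat.exists_eq_add_of_le hj'
        rw [← hw1 l (by omega), hw2 l (by omega)]
        congr 1; omega
    · apply List.ext_getElem (by simp)
      intro j h1 h2
      simp [hw0 j h1]
  · rintro ⟨hn, ⟨-, hc⟩, hw'⟩
    have hw0 : ∀ j (hj : j < w.length), w[j] = fibWord (i + j) := fun j hj => by
      rw [List.getElem_of_eq hw']
      simp
    refine ⟨by simp; omega, fun j hj => ?_⟩
    simp only [List.length_append] at hj
    simp only [List.getElem_drop, List.getElem_map, List.getElem_range]
    rcases lt_or_ge j w.length with h1 | h1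
    · rw [List.getElem_append_left (by simp; omega), List.getElem_append_left h1, hw0]
    obtain ⟨l, rfl⟩ := Nat.exists_eq_add_of_le h1
    rcases lt_or_ge l w.length with h2 | h2
    · rw [List.getElem_append_left (by simp; omega), List.getElem_append_right (by omega), hw0,
        hc _ (by omega)]
      congr 1; omega
    · obtain ⟨r, rfl⟩ := Nat.exists_eq_add_of_le h2
      have hr : w.length + (w.length + r) - (w ++ w).length = r := by simp [← add_assoc]
      rw [List.getElem_append_right (by simp), hw0]
      simp only [hr]
      rw [hc r (by omega), add_assoc, hc (r + w.length) (by omega)]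
      congr 1; omega

lemma D_eq_card (n : ℕ) : D n = (cubes n).card := by
  rw [← Set.ncard_coe_finset, D, fibPrefix_eq_map]
  refine Set.ncard_congr (fun q _ => (q.1.length, q.2)) ?_ ?_ ?_
  · rintro ⟨w, i⟩ ⟨hw, h⟩
    have := (cube_prefix_iff hw).1 h
    exact mem_cubes.2 ⟨this.1, this.2.1⟩
  · rintro ⟨w, i⟩ ⟨v, j⟩ ⟨hw, h⟩ ⟨hv, h'⟩ he
    obtain ⟨he1, he2⟩ := Prod.mk.inj he
    dsimp only at he1 he2 hw hv h h'
    subst he2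
    rw [((cube_prefix_iff hw).1 h).2.2, ((cube_prefix_iff hv).1 h').2.2, he1]
  · rintro ⟨p, i⟩ h
    obtain ⟨h1, h2⟩ := mem_cubes.1 h
    have hlen : ((List.range p).map fun j => fibWord (i + j)).length = p := by simp
    have hne : ((List.range p).map fun j => fibWord (i + j)) ≠ [] := by
      rw [← List.length_pos_iff, hlen]; exact h2.1
    refine ⟨((List.range p).map fun j => fibWord (i + j), i), ⟨hne, ?_⟩, by simp⟩
    exact (cube_prefix_iff hne).2 ⟨by rwa [hlen], by rwa [hlen], by rw [hlen]⟩

lemma isCubeAt_iff {p i : ℕ} : IsCubeAt p i ↔ 0 < p ∧ ∃ c : ℤ, ∀ N : ℤ,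
    i + 1 ≤ N → N ≤ i + 1 + 2 * p → beatty (N + p) = beatty N + c := by
  refine and_congr_right fun _ => ?_
  constructor
  · intro h
    refine ⟨beatty (i + 1 + p) - beatty (i + 1), fun N h1 h2 => ?_⟩
    obtain ⟨j, rfl⟩ := Int.le.dest h1
    have hj : j ≤ 2 * p := by omega
    clear h1 h2
    induction j with
    | zero => simp
    | succ j ih =>
      specialize ih (by omega)
      have hj' := h j (by omega)
      unfold fibWord at hj'
      rw [decide_eq_decide] at hj'
      push_cast at hj' ih ⊢
      rw [show (i : ℤ) + j + 2 = i + 1 + j + 1 by ring, show (i : ℤ) + j + 1 = i + 1 + j by ring,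
        show (i : ℤ) + j + p + 2 = i + 1 + j + p + 1 by ring,
        show (i : ℤ) + j + p + 1 = i + 1 + j + p by ring] at hj'
      rw [show (i : ℤ) + 1 + (j + 1) + p = i + 1 + j + p + 1 by ring,
        show (i : ℤ) + 1 + (j + 1) = i + 1 + j + 1 by ring]
      have s1 := beatty_succ (i + 1 + j)
      have s2 := beatty_succ (i + 1 + j + p)
      omega
  · rintro ⟨c, h⟩ j hj
    have e1 := h (i + 1 + j) (by omega) (by omega)
    have e2 := h (i + 2 + j) (by omega) (by omega)
    unfold fibWord
    rw [decide_eq_decide]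
    push_cast
    rw [show (i : ℤ) + j + 2 = i + 2 + j by ring, show (i : ℤ) + j + 1 = i + 1 + j by ring,
      show (i : ℤ) + j + p + 2 = i + 2 + j + p by ring,
      show (i : ℤ) + j + p + 1 = i + 1 + j + p by ring, e1, e2]
    omega

lemma isCubeAt_fib_iff {k i : ℕ} (hk : 1 ≤ k) : IsCubeAt (Nat.fib (k + 1)) i ↔
    ∀ x : ℤ, 1 ≤ x → jump k x < i + 1 ∨ (i : ℤ) + 1 + 2 * Nat.fib (k + 1) < jump k x := by
  have hp : 0 < Nat.fib (k + 1) := Nat.fib_pos.2 (by omega)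
  have hf : (2 : ℤ) ≤ Nat.fib (k + 2) := by
    exact_mod_cast Nat.fib_mono (show 3 ≤ k + 2 by omega)
  rw [isCubeAt_iff]
  constructor
  · rintro ⟨-, c, h⟩ x hx
    by_contra! hc
    have key : ∀ N : ℤ, i + 1 ≤ N → N ≤ i + 1 + 2 * Nat.fib (k + 1) →
        ∃ y : ℤ, N = jump k y := by
      intro N h1 h2
      have hb := (beatty_add_fib_ne_iff (k := k) (N := jump k x) (by omega)).2 ⟨x, hx, rfl⟩
      rw [h _ hc.1 hc.2] at hb
      obtain ⟨y, -, hy⟩ := (beatty_add_fib_ne_iff (k := k) (N := N) (by omega)).1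
        (by rw [h N h1 h2]; omega)
      exact ⟨y, hy⟩
    obtain ⟨y, hy⟩ := key (i + 1) le_rfl (by omega)
    obtain ⟨z, hz⟩ := key (i + 2) (by omega) (by omega)
    have hyz : y < z := (jump_lt_iff (k := k)).1 (by omega)
    have := jump_add_le (k := k) hyz.le
    nlinarith
  · intro h
    refine ⟨hp, Nat.fib k, fun N h1 h2 => ?_⟩
    by_contra hne
    obtain ⟨x, hx, rfl⟩ := (beatty_add_fib_ne_iff (by omega)).1 hne
    have := h x hx
    omega

lemma not_isCubeAt_of_fib_lt {k p i : ℕ} (h1 : Nat.fib (k + 2) < p) (h2 : p < Nat.fib (k + 3)) :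
    ¬ IsCubeAt p i := by
  rw [isCubeAt_iff]
  rintro ⟨-, c, h⟩
  have e2 := fib_add_two_int k
  have e3 : (Nat.fib (k + 3) : ℤ) = Nat.fib (k + 1) + Nat.fib (k + 2) := fib_add_two_int (k + 1)
  have hle : (Nat.fib k : ℤ) ≤ Nat.fib (k + 1) := by exact_mod_cast Nat.fib_le_fib_succ
  have h0 : (0 : ℤ) ≤ Nat.fib k := by positivity
  have transfer : ∀ N : ℤ, i + 1 ≤ N → N + Nat.fib (k + 1) ≤ i + 1 + 2 * p →
      ((∃ x : ℤ, 1 ≤ x ∧ N = jump k x) ↔ ∃ x : ℤ, 1 ≤ x ∧ N + p = jump k x) := by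
    intro N ha hb
    rw [← beatty_add_fib_ne_iff (by omega), ← beatty_add_fib_ne_iff (by omega),
      show N + p + Nat.fib (k + 1) = N + Nat.fib (k + 1) + (p : ℤ) by ring,
      h N ha (by omega), h (N + Nat.fib (k + 1)) (by omega) (by omega)]
    omega
  have apart : ∀ x y : ℤ, jump k x + p ≠ jump k y := by
    intro x y hxy
    have hlt : x < y := (jump_lt_iff (k := k)).1 (by omega)
    rcases (show x + 1 ≤ y from hlt).eq_or_lt with rfl | hlt2
    · have := jump_succ k x
      omega
    · have := jump_add_le (k := k) hlt.le
      nlinarith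
  obtain ⟨x, hx, hx1, hx2⟩ := exists_jump_mem (k := k) (a := i) (by omega)
  by_cases hc : jump k x + Nat.fib (k + 1) ≤ i + 1 + 2 * p
  · obtain ⟨y, -, hy⟩ := (transfer _ (by omega) hc).1 ⟨x, hx, rfl⟩
    exact apart x y hy
  · obtain ⟨y, -, hy⟩ := (transfer (jump k x - p) (by omega) (by omega)).2 ⟨x, hx, by ring⟩
    exact apart y x (by omega)

lemma IsCubeAt.exists_eq_fib {p i : ℕ} (h : IsCubeAt p i) : ∃ k, 1 ≤ k ∧ p = Nat.fib (k + 1) := by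
  have hp := h.1
  have h1 := Nat.fib_greatestFib_le p
  have h2 := Nat.lt_fib_greatestFib_add_one p
  obtain ⟨k, hk⟩ : ∃ k, Nat.greatestFib p = k + 2 := by
    refine ⟨Nat.greatestFib p - 2, ?_⟩
    have h3 : ¬ Nat.greatestFib p + 1 ≤ 2 := fun hle => by
      have := Nat.fib_mono hle
      rw [Nat.fib_two] at this
      omega
    omega
  rw [hk] at h1 h2
  rcases h1.eq_or_lt with h1 | h1
  · exact ⟨k + 1, by omega, h1.symm⟩
  · exact absurd h (not_isCubeAt_of_fib_lt h1 h2)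

/-- Around position `fib (m + 3)` there is a long gap between consecutive jumps which either
ends at `fib (m + 3)` or starts `fib (k + 1)` before it. -/
lemma exists_long_gap {k m : ℕ} (hkm : k ≤ m) : ∃ x : ℤ, 1 ≤ x ∧
    jump k (x + 1) = jump k x + Nat.fib (k + 3) ∧
      (k < m ∧ jump k x + Nat.fib (k + 3) = Nat.fib (m + 3) ∨
        jump k x + Nat.fib (k + 1) = Nat.fib (m + 3)) := by
  obtain ⟨d, rfl⟩ := Nat.exists_eq_add_of_le hkm
  have a1 := goldenConj_lt_neg_half
  have a2 := neg_two_thirds_lt_goldenConj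
  have hq : (Nat.fib (k + d + 3) : ℤ) =
      Nat.fib (d + 2) * Nat.fib (k + 2) + Nat.fib (d + 1) * Nat.fib (k + 1) := by
    rw [show k + d + 3 = (d + 1) + (k + 1) + 1 by ring, Nat.fib_add]
    push_cast; ring
  have h3 : (Nat.fib (k + 3) : ℤ) = Nat.fib (k + 1) + Nat.fib (k + 2) := fib_add_two_int (k + 1)
  have hX : (1 : ℤ) ≤ Nat.fib (d + 2) := by exact_mod_cast Nat.fib_pos.2 (by omega)
  have key := Real.goldenConj_mul_fib_succ_add_fib (d + 1)
  rw [show d + 1 + 1 = d + 2 by rfl] at key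
  have hsq := Real.goldenConj_sq
  rcases Nat.even_or_odd d with hd | hd
  · have hz0 : 0 < ψ ^ (d + 2) :=
      (Even.add hd even_two).pow_pos Real.goldenConj_ne_zero
    have hz1 : ψ ^ (d + 2) ≤ ψ ^ 2 := by
      rw [pow_add]
      have : ψ ^ d ≤ 1 := by
        rw [← hd.pow_abs]
        exact pow_le_one₀ (abs_nonneg _) (abs_le.2 ⟨by linarith, by linarith⟩)
      nlinarith [sq_nonneg ψ]
    have b0 : beatty (Nat.fib (d + 2)) = Nat.fib (d + 1) - 1 :=
      (beatty_eq_iff (by omega)).2 (by push_cast; constructor <;> linarith)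
    have b1 : beatty (Nat.fib (d + 2) + 1) = Nat.fib (d + 1) :=
      (beatty_eq_iff (by omega)).2 (by push_cast; constructor <;> linarith)
    refine ⟨Nat.fib (d + 2), hX, ?_, Or.inr ?_⟩
    · rw [jump, jump, b0, b1, h3]; ring
    · rw [jump, b0, hq]; ring
  · have hz0 : ψ ^ (d + 2) < 0 :=
      (Odd.add_even hd even_two).pow_neg Real.goldenConj_neg
    have hz1 : -ψ ^ (d + 2) ≤ ψ ^ 2 := by
      rw [← (Odd.add_even hd even_two).neg_pow, ← even_two.neg_pow]
      exact pow_le_pow_of_le_one (by linarith) (by linarith) (by omega)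
    have hd1 : 1 ≤ d := hd.pos
    have hX' : (2 : ℤ) ≤ Nat.fib (d + 2) := by
      exact_mod_cast Nat.fib_mono (show 3 ≤ d + 2 by omega)
    have b0 : beatty (Nat.fib (d + 2) - 1) = Nat.fib (d + 1) - 1 :=
      (beatty_eq_iff (by omega)).2 (by push_cast; constructor <;> linarith)
    have b1 : beatty (Nat.fib (d + 2) - 1 + 1) = Nat.fib (d + 1) := by
      rw [sub_add_cancel]
      exact (beatty_eq_iff (by omega)).2 (by push_cast; constructor <;> linarith)
    refine ⟨Nat.fib (d + 2) - 1, by omega, ?_, Or.inl ⟨by omega, ?_⟩⟩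
    · rw [jump, jump, b0, b1, h3]; ring
    · rw [jump, b0, hq, h3]; ring

lemma fib_eq_one_or_lt_succ {k : ℕ} (hk : 1 ≤ k) :
    Nat.fib k = 1 ∨ Nat.fib k < Nat.fib (k + 1) := by
  rcases hk.eq_or_lt with rfl | hk2
  · exact Or.inl rfl
  · exact Or.inr (Nat.fib_lt_fib_succ hk2)

/-- The cubes of the prefix of length `fib (m + 4)` straddling position `fib (m + 3)`. -/
def IsCrossing (m p i : ℕ) : Prop :=
  i + 3 * p ≤ Nat.fib (m + 4) ∧ IsCubeAt p i ∧ i < Nat.fib (m + 3) ∧ Nat.fib (m + 3) < i + 3 * p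

lemma isCrossing_fib_iff {k m : ℕ} (hk : 1 ≤ k) (hkm : k < m) : ∃ a : ℕ, ∀ i : ℕ,
    IsCrossing m (Nat.fib (k + 1)) i ↔ i ∈ Finset.Ico a (a + (Nat.fib k - 1)) := by
  obtain ⟨x, hx, hgap, hpos⟩ := exists_long_gap hkm.le
  have e2 : Nat.fib (k + 2) = Nat.fib k + Nat.fib (k + 1) := Nat.fib_add_two
  have e3 : Nat.fib (k + 3) = Nat.fib (k + 1) + Nat.fib (k + 2) := Nat.fib_add_two
  have e4 : Nat.fib (m + 4) = Nat.fib (m + 2) + Nat.fib (m + 3) := Nat.fib_add_two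
  have hle : Nat.fib (k + 3) ≤ Nat.fib (m + 2) := Nat.fib_mono (by omega)
  have hf0 : 0 < Nat.fib k := Nat.fib_pos.2 hk
  have hf1 : 0 < Nat.fib (k + 1) := Nat.fib_pos.2 (by omega)
  have hfle := fib_eq_one_or_lt_succ hk
  have hj := fib_add_two_le_jump (k := k) hx
  obtain ⟨a, ha⟩ := Int.eq_ofNat_of_zero_le (show 0 ≤ jump k x by omega)
  refine ⟨a, fun i => ?_⟩
  rw [Finset.mem_Ico, IsCrossing, isCubeAt_fib_iff hk]
  constructor
  · rintro ⟨h1, h2, h3, h4⟩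
    have c1 := h2 x hx
    have c2 := h2 (x + 1) (by omega)
    omega
  · rintro ⟨h1, h2⟩
    refine ⟨by omega, fun y hy => ?_, by omega, by omega⟩
    rcases le_or_gt y x with hyx | hyx
    · have := jump_add_le (k := k) hyx
      have : (0 : ℤ) ≤ (x - y) * Nat.fib (k + 2) := mul_nonneg (by omega) (by omega)
      omega
    · have := jump_add_le (k := k) (show x + 1 ≤ y from hyx)
      have : (0 : ℤ) ≤ (y - (x + 1)) * Nat.fib (k + 2) := mul_nonneg (by omega) (by omega)
      omega

lemma IsCrossing.exists_eq_fib {m p i : ℕ} (hm : 1 ≤ m) (h : IsCrossing m p i) :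
    ∃ k, 1 ≤ k ∧ k < m ∧ p = Nat.fib (k + 1) := by
  obtain ⟨h1, h2, h3, h4⟩ := h
  obtain ⟨k, hk, rfl⟩ := h2.exists_eq_fib
  refine ⟨k, hk, ?_, rfl⟩
  have e2 : Nat.fib (m + 2) = Nat.fib m + Nat.fib (m + 1) := Nat.fib_add_two
  have e3 : Nat.fib (m + 3) = Nat.fib (m + 1) + Nat.fib (m + 2) := Nat.fib_add_two
  have e4 : Nat.fib (m + 4) = Nat.fib (m + 2) + Nat.fib (m + 3) := Nat.fib_add_two
  have hle := fib_eq_one_or_lt_succ hm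
  have hp0 : 0 < Nat.fib m := Nat.fib_pos.2 hm
  by_contra! hmk
  rcases hmk.eq_or_lt with rfl | hmk
  · obtain ⟨x, hx, hgap, ⟨hlt, -⟩ | hpos⟩ := exists_long_gap (le_refl m)
    · omega
    · have c1 := (isCubeAt_fib_iff hk).1 h2 x hx
      have c2 := (isCubeAt_fib_iff hk).1 h2 (x + 1) (by omega)
      omega
  · have : Nat.fib (m + 2) ≤ Nat.fib (k + 1) := Nat.fib_mono (by omega)
    omega

open Classical in
lemma card_crossing {m : ℕ} (hm : 1 ≤ m) :
    ((cubes (Nat.fib (m + 4))).filter fun q => IsCrossing m q.1 q.2).card =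
      ∑ k ∈ Finset.Ico 1 m, (Nat.fib k - 1) := by
  have hex : ∀ k : ℕ, ∃ a : ℕ, 1 ≤ k → k < m → ∀ i : ℕ,
      IsCrossing m (Nat.fib (k + 1)) i ↔ i ∈ Finset.Ico a (a + (Nat.fib k - 1)) := by
    intro k
    by_cases hk : 1 ≤ k ∧ k < m
    · obtain ⟨a, ha⟩ := isCrossing_fib_iff hk.1 hk.2
      exact ⟨a, fun _ _ => ha⟩
    · exact ⟨0, fun h1 h2 => absurd ⟨h1, h2⟩ hk⟩
  choose a ha using hex
  have heq : (cubes (Nat.fib (m + 4))).filter (fun q => IsCrossing m q.1 q.2) =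
      (Finset.Ico 1 m).biUnion fun k =>
        ({Nat.fib (k + 1)} : Finset ℕ) ×ˢ Finset.Ico (a k) (a k + (Nat.fib k - 1)) := by
    ext ⟨p, i⟩
    rw [Finset.mem_filter, mem_cubes, Finset.mem_biUnion]
    simp only [Finset.mem_product, Finset.mem_singleton]
    constructor
    · rintro ⟨-, h⟩
      obtain ⟨k, hk, hkm, rfl⟩ := h.exists_eq_fib hm
      exact ⟨k, Finset.mem_Ico.2 ⟨hk, hkm⟩, rfl, (ha k hk hkm i).1 h⟩
    · rintro ⟨k, hk, rfl, hi⟩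
      rw [Finset.mem_Ico] at hk
      have h := (ha k hk.1 hk.2 i).2 hi
      exact ⟨⟨h.1, h.2.1⟩, h⟩
  rw [heq, Finset.card_biUnion]
  · simp
  · intro k hk l hl hkl
    rw [Finset.mem_coe, Finset.mem_Ico] at hk hl
    change Disjoint _ _
    rw [Finset.disjoint_left]
    rintro ⟨p, i⟩ h1 h2
    simp only [Finset.mem_product, Finset.mem_singleton] at h1 h2
    have := Nat.fib_strictMonoOn.injOn (show 2 ≤ k + 1 by omega) (show 2 ≤ l + 1 by omega)
      (h1.1.symm.trans h2.1)
    omega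

lemma isCubeAt_fib_add_iff {m p i : ℕ} (h : i + 3 * p ≤ Nat.fib (m + 2)) :
    IsCubeAt p (Nat.fib (m + 3) + i) ↔ IsCubeAt p i := by
  refine and_congr_right fun hp => forall₂_congr fun j hj => ?_
  rw [add_assoc, fibWord_fib_add (by omega), add_assoc (Nat.fib (m + 3)),
    fibWord_fib_add (by omega)]

lemma card_cubes_fib {m : ℕ} (hm : 1 ≤ m) : (cubes (Nat.fib (m + 4))).card =
    (cubes (Nat.fib (m + 3))).card + (cubes (Nat.fib (m + 2))).card +
      ∑ k ∈ Finset.Ico 1 m, (Nat.fib k - 1) := by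
  classical
  have e4 : Nat.fib (m + 4) = Nat.fib (m + 2) + Nat.fib (m + 3) := Nat.fib_add_two
  have hinj : Function.Injective fun q : ℕ × ℕ => (q.1, Nat.fib (m + 3) + q.2) := by
    rintro ⟨p, i⟩ ⟨p', i'⟩ h
    simpa using h
  rw [← card_crossing hm, ← Finset.card_image_of_injective (cubes (Nat.fib (m + 2))) hinj,
    ← Finset.card_union_of_disjoint, ← Finset.card_union_of_disjoint]
  · congr 1
    ext ⟨p, i⟩
    simp only [Finset.mem_union, Finset.mem_filter, Finset.mem_image, mem_cubes, Prod.exists,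
      Prod.mk.injEq]
    constructor
    · rintro ⟨h1, h2⟩
      rcases le_or_gt (i + 3 * p) (Nat.fib (m + 3)) with h3 | h3
      · exact Or.inl (Or.inl ⟨h3, h2⟩)
      rcases lt_or_ge i (Nat.fib (m + 3)) with h4 | h4
      · exact Or.inr ⟨⟨h1, h2⟩, h1, h2, h4, h3⟩
      · obtain ⟨j, rfl⟩ := Nat.exists_eq_add_of_le h4
        have h5 : j + 3 * p ≤ Nat.fib (m + 2) := by omega
        exact Or.inl (Or.inr ⟨p, j, ⟨h5, (isCubeAt_fib_add_iff h5).1 h2⟩, rfl, rfl⟩)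
    · rintro ((⟨h1, h2⟩ | ⟨p, j, ⟨h1, h2⟩, rfl, rfl⟩) | h)
      · exact ⟨by omega, h2⟩
      · exact ⟨by omega, (isCubeAt_fib_add_iff h1).2 h2⟩
      · exact h.1
  · rw [Finset.disjoint_left]
    rintro ⟨p, i⟩ h1 h2
    obtain ⟨-, -, -, h3, h4⟩ := Finset.mem_filter.1 h2
    rcases Finset.mem_union.1 h1 with h1 | h1
    · have := (mem_cubes.1 h1).1
      dsimp only at h4
      omega
    · obtain ⟨⟨p', j⟩, -, hj⟩ := Finset.mem_image.1 h1
      obtain ⟨rfl, rfl⟩ := Prod.mk.inj hj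
      dsimp only at h3
      omega
  · rw [Finset.disjoint_left]
    rintro ⟨p, i⟩ h1 h2
    obtain ⟨⟨p', j⟩, -, hj⟩ := Finset.mem_image.1 h2
    obtain ⟨rfl, rfl⟩ := Prod.mk.inj hj
    obtain ⟨h3, h4⟩ := mem_cubes.1 h1
    have := h4.1
    omega

lemma sum_fib_sub_one (m : ℕ) :
    ∑ k ∈ Finset.Ico 1 (m + 1), (Nat.fib k - 1) + (m + 1) = Nat.fib (m + 2) := by
  induction m with
  | zero => simp
  | succ m ih =>
    have e : Nat.fib (m + 1 + 2) = Nat.fib (m + 1) + Nat.fib (m + 2) := Nat.fib_add_two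
    have hp : 0 < Nat.fib (m + 1) := Nat.fib_pos.2 (by omega)
    rw [Finset.sum_Ico_succ_top (by omega)]
    omega

lemma cubes_two : cubes 2 = ∅ := by
  rw [Finset.eq_empty_iff_forall_notMem]
  rintro ⟨p, i⟩ h
  obtain ⟨h1, h2, -⟩ := mem_cubes.1 h
  omega

lemma cubes_three : cubes 3 = ∅ := by
  rw [Finset.eq_empty_iff_forall_notMem]
  rintro ⟨p, i⟩ h
  obtain ⟨h1, h2, h3⟩ := mem_cubes.1 h
  obtain rfl : p = 1 := by omega
  obtain rfl : i = 0 := by omega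
  have := h3 0 (by omega)
  simp [fibWord_zero, fibWord_one] at this

lemma card_cubes_fib_eq (m : ℕ) : ((cubes (Nat.fib (m + 3))).card : ℚ) =
    ((m : ℚ) - 10) / 5 * Nat.fib (m + 2) + ((m : ℚ) + 2) / 5 * Nat.fib m + m + 2 := by
  induction m using Nat.twoStepInduction with
  | zero => norm_num [show Nat.fib 3 = 2 from rfl, cubes_two]
  | one => norm_num [show Nat.fib 4 = 3 from rfl, show Nat.fib 3 = 2 from rfl, cubes_three]
  | more m ih1 ih2 =>
    have h := card_cubes_fib (show 1 ≤ m + 1 by omega)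
    have hs := sum_fib_sub_one m
    have e2 : Nat.fib (m + 2) = Nat.fib m + Nat.fib (m + 1) := Nat.fib_add_two
    have e3 : Nat.fib (m + 3) = Nat.fib (m + 1) + Nat.fib (m + 2) := Nat.fib_add_two
    have e4 : Nat.fib (m + 4) = Nat.fib (m + 2) + Nat.fib (m + 3) := Nat.fib_add_two
    have h' : (cubes (Nat.fib (m + 2 + 3))).card + (m + 1) = (cubes (Nat.fib (m + 1 + 3))).card +
        (cubes (Nat.fib (m + 3))).card + Nat.fib (m + 2) := by
      rw [← hs]
      simp only [show m + 1 + 4 = m + 2 + 3 from rfl, show m + 1 + 2 = m + 3 from rfl] at h ⊢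
      omega
    have hq : ((cubes (Nat.fib (m + 2 + 3))).card : ℚ) + (m + 1) =
        (cubes (Nat.fib (m + 1 + 3))).card + (cubes (Nat.fib (m + 3))).card +
          Nat.fib (m + 2) := by exact_mod_cast h'
    rw [ih1, ih2] at hq
    simp only [show m + 2 + 2 = m + 4 from rfl, show m + 1 + 2 = m + 3 from rfl, e4, e3, e2]
      at hq ⊢
    push_cast at hq ⊢
    linear_combination hq

/-- With `f_m = Nat.fib (m + 2)`: for `m ≥ 6`,
`D(f_m) = (m-11)/5 · f_{m-1} + (m+1)/5 · f_{m-3} + m + 1`. -/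
theorem stmt_17 (m : ℕ) (hm : 6 ≤ m) :
    (D (Nat.fib (m + 2)) : ℚ) =
      ((m : ℚ) - 11) / 5 * Nat.fib (m + 1) +
        ((m : ℚ) + 1) / 5 * Nat.fib (m - 1) + m + 1 := by
  obtain ⟨n, rfl⟩ := Nat.exists_eq_add_of_le (show 1 ≤ m by omega)
  rw [D_eq_card, show 1 + n + 2 = n + 3 by ring, card_cubes_fib_eq,
    show 1 + n + 1 = n + 2 by ring, show 1 + n - 1 = n by omega]
  push_cast
  ring
end
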